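/- arXiv:1606.01107 — 7 statements merged into one kernel-verified Lean document; each statement's English description precedes it below -/
import Mathlib

section
/- Let Θ = Θ_{ℓ1,…,ℓp} be a generalized theta graph with p ≥ 3. There exists a packing 4-coloring π of Θ with π(u) = 2 and π(v) = 4 if and only if one of the following conditions holds: (i) n_1 ≤ 1 and n_3 = n_7 = 0; (ii) n_1 ≤ 1, n_3 = n_4 = 0, n_7 ≤ 1 and n_8 = 0; (iii) n_1 ≤ 1, n_3 ≤ 1 and n_4 = n_7 = n_8 = 0; (iv) n_1 = n_2 = n_3 = 0 and n_7 ≤ 1; (v) n_1 = n_2 = n_3 = n_4 = 0, n_7 = 2 and n_8 = 0; (vi) n_1 = n_2 = 0, n_3 ≤ 1, n_4 = 0 and n_7 + n_8 ≤ 1; (vii) n_1 = n_3 = n_7 = 0; (viii) n_1 = n_3 = n_4 = 0, n_7 ≤ 1 and n_8 = 0; (ix) n_1 = 0, n_3 ≤ 1 and n_4 = n_7 = n_8 = 0. -/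
/-- A packing `k`-coloring of an undirected graph `G`: colors lie in `{1,…,k}` and
two distinct vertices sharing color `i` are at distance greater than `i`. -/
def IsPackingColoring {V : Type*} (G : SimpleGraph V) (k : ℕ) (π : V → ℕ) : Prop :=
  (∀ x, 1 ≤ π x ∧ π x ≤ k) ∧
  ∀ x y : V, x ≠ y → π x = π y → (π x : ℕ∞) < G.edist x y

/-- The packing chromatic number of an undirected graph. -/
noncomputable def packingChromaticNumber {V : Type*} (G : SimpleGraph V) : ℕ :=
  sInf {k | ∃ π : V → ℕ, IsPackingColoring G k π}

/-- Vertices of the generalized theta graph `Θ_{ℓ 0, …, ℓ (p-1)}`: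
`Sum.inl false` is the end-vertex `u`, `Sum.inl true` is the end-vertex `v`, and
`Sum.inr ⟨i, j⟩` is the internal vertex `x_i^{j+1}` of the `i`-th path. -/
def ThetaVert (p : ℕ) (ℓ : Fin p → ℕ) : Type :=
  Bool ⊕ (Σ i : Fin p, Fin (ℓ i - 1))

/-- Base relation generating the edges of the generalized theta graph. -/
def thetaRel (p : ℕ) (ℓ : Fin p → ℕ) : ThetaVert p ℓ → ThetaVert p ℓ → Prop
  | Sum.inl a, Sum.inl b => a = false ∧ b = true ∧ ∃ i, ℓ i = 1
  | Sum.inl a, Sum.inr ⟨i, j⟩ =>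
      (a = false ∧ (j : ℕ) = 0) ∨ (a = true ∧ (j : ℕ) + 2 = ℓ i)
  | Sum.inr ⟨i, j⟩, Sum.inr ⟨i', j'⟩ => (i : ℕ) = (i' : ℕ) ∧ (j : ℕ) + 1 = (j' : ℕ)
  | Sum.inr _, Sum.inl _ => False

/-- The generalized theta graph `Θ_{ℓ 0, …, ℓ (p-1)}`. -/
def thetaGraph (p : ℕ) (ℓ : Fin p → ℕ) : SimpleGraph (ThetaVert p ℓ) :=
  SimpleGraph.fromRel (thetaRel p ℓ)

/-- The end-vertex `u` of the generalized theta graph. -/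
def thetaU (p : ℕ) (ℓ : Fin p → ℕ) : ThetaVert p ℓ := Sum.inl false

/-- The end-vertex `v` of the generalized theta graph. -/
def thetaV (p : ℕ) (ℓ : Fin p → ℕ) : ThetaVert p ℓ := Sum.inl true

/-- `pathCount p ℓ m` is `n_m`, the number of paths of length `m`. -/
def pathCount (p : ℕ) (ℓ : Fin p → ℕ) (m : ℕ) : ℕ :=
  (Finset.univ.filter (fun i : Fin p => ℓ i = m)).card

/-- `longPathCount p ℓ` is `Σ_{i ≥ 3} n_i`, the number of paths of length at least `3`. -/
def longPathCount (p : ℕ) (ℓ : Fin p → ℕ) : ℕ :=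
  (Finset.univ.filter (fun i : Fin p => 3 ≤ ℓ i)).card

/-- Conditions (A)–(N) on the multiset of path lengths of a generalized theta graph. -/
def CondAN (p : ℕ) (ℓ : Fin p → ℕ) : Prop :=
  let n := pathCount p ℓ
  -- (A)
  (n 1 = 0 ∧ n 2 = 0 ∧ n 3 = 0 ∧ n 4 = 0) ∨
  -- (B)
  (n 1 = 0 ∧ n 2 = 0 ∧ n 3 = 0 ∧ n 5 ≤ 2 ∧ n 5 + n 6 ≤ 4) ∨
  -- (C)
  (n 1 = 0 ∧ n 2 = 0 ∧ n 3 = 0 ∧ n 7 ≤ 1) ∨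
  -- (D)
  (n 1 = 0 ∧ n 2 = 0 ∧ n 3 = 0 ∧ n 5 + n 6 + n 7 ≤ 2) ∨
  -- (E)
  (n 1 = 0 ∧ n 2 = 0 ∧ n 3 ≤ 1 ∧ n 5 = 0 ∧ n 6 = 0 ∧ n 7 = 0) ∨
  -- (F)
  (n 1 = 0 ∧ n 2 = 0 ∧ n 3 ≤ 1 ∧ n 4 = 0 ∧ n 7 + n 8 ≤ 1) ∨
  -- (G)
  (n 1 = 0 ∧ n 3 = 0 ∧ n 4 = 0 ∧ n 7 ≤ 1 ∧ n 8 = 0) ∨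
  -- (H)
  (n 1 = 0 ∧ n 3 ≤ 2 ∧ (n 5 = 0 ∨ n 5 + n 6 ≤ 1)) ∨
  -- (I)
  (n 1 = 0 ∧ n 3 + n 4 + n 5 ≤ 1) ∨
  -- (J)
  (n 1 ≤ 1 ∧ n 3 ≤ 2 ∧ n 5 = 0 ∧ n 6 = 0) ∨
  -- (K)
  (n 1 ≤ 1 ∧ n 3 = 0 ∧ n 7 = 0) ∨
  -- (L)
  (n 1 ≤ 1 ∧ n 3 = 0 ∧ n 4 = 0 ∧ n 7 ≤ 1 ∧ n 8 = 0) ∨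
  -- (M)
  (n 1 ≤ 1 ∧ n 3 ≤ 1 ∧ n 4 = 0 ∧ n 7 = 0 ∧ n 8 = 0) ∨
  -- (N)
  (n 1 ≤ 1 ∧ longPathCount p ℓ ≤ 1)

/-- `DirPath A m x y` holds when there is a directed walk of length `m`
from `x` to `y` following the arc relation `A`. -/
def DirPath {V : Type*} (A : V → V → Prop) : ℕ → V → V → Prop
  | 0, x, y => x = y
  | m + 1, x, y => ∃ z, A x z ∧ DirPath A m z y

/-- The weak directed distance between `x` and `y`: the number of arcs in a shortest
directed path linking `x` and `y`, in either direction (`⊤` if none exists). -/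
noncomputable def weakEDist {V : Type*} (A : V → V → Prop) (x y : V) : ℕ∞ :=
  sInf {n : ℕ∞ | ∃ m : ℕ, (DirPath A m x y ∨ DirPath A m y x) ∧ n = (m : ℕ∞)}

/-- A packing `k`-coloring of an oriented graph with arc relation `A`. -/
def IsDirPackingColoring {V : Type*} (A : V → V → Prop) (k : ℕ) (π : V → ℕ) : Prop :=
  (∀ x, 1 ≤ π x ∧ π x ≤ k) ∧
  ∀ x y : V, x ≠ y → π x = π y → (π x : ℕ∞) < weakEDist A x y

/-- The packing chromatic number of an oriented graph with arc relation `A`. -/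
noncomputable def dirPackingChromaticNumber {V : Type*} (A : V → V → Prop) : ℕ :=
  sInf {k | ∃ π : V → ℕ, IsDirPackingColoring A k π}

/-- `A` is an orientation of the undirected graph `G`: every edge of `G` receives
exactly one of its two possible directions. -/
def IsOrientation {V : Type*} (G : SimpleGraph V) (A : V → V → Prop) : Prop :=
  (∀ x y : V, G.Adj x y ↔ (A x y ∨ A y x)) ∧ (∀ x y : V, A x y → ¬ A y x)


/-- Internal vertex. -/
def tX {p : ℕ} (ℓ : Fin p → ℕ) (i : Fin p) (j : Fin (ℓ i - 1)) : ThetaVert p ℓ := Sum.inr ⟨i, j⟩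

/-- The vertex at position `a` of path `i`. -/
def tv (p : ℕ) (ℓ : Fin p → ℕ) (i : Fin p) (a : ℕ) : ThetaVert p ℓ :=
  if h : a = 0 then thetaU p ℓ
  else if h2 : a < ℓ i then tX ℓ i ⟨a - 1, by omega⟩ else thetaV p ℓ

/-- Injective numerical key of a vertex. -/
def tkey {p : ℕ} {ℓ : Fin p → ℕ} : ThetaVert p ℓ → ℕ × ℕ
  | Sum.inl false => (p, 0)
  | Sum.inl true => (p, 1)
  | Sum.inr ⟨i, j⟩ => (i, j + 1)

theorem tkey_U {p : ℕ} {ℓ : Fin p → ℕ} : tkey (thetaU p ℓ) = (p, 0) := rfl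
theorem tkey_V {p : ℕ} {ℓ : Fin p → ℕ} : tkey (thetaV p ℓ) = (p, 1) := rfl
theorem tkey_X {p : ℕ} {ℓ : Fin p → ℕ} (i : Fin p) (j : Fin (ℓ i - 1)) :
    tkey (tX ℓ i j) = ((i : ℕ), (j : ℕ) + 1) := rfl

theorem ne_of_key {p : ℕ} {ℓ : Fin p → ℕ} {x y : ThetaVert p ℓ} (h : tkey x ≠ tkey y) : x ≠ y :=
  fun e => h (congrArg tkey e)

theorem tv_zero {p : ℕ} {ℓ : Fin p → ℕ} (i : Fin p) : tv p ℓ i 0 = thetaU p ℓ := by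
  unfold tv; rw [dif_pos rfl]

theorem tv_end {p : ℕ} {ℓ : Fin p → ℕ} (i : Fin p) (a : ℕ) (h0 : a ≠ 0) (h : ¬ a < ℓ i) :
    tv p ℓ i a = thetaV p ℓ := by
  unfold tv; rw [dif_neg h0, dif_neg h]

theorem tv_last {p : ℕ} {ℓ : Fin p → ℕ} (hpos : ∀ i, 1 ≤ ℓ i) (i : Fin p) :
    tv p ℓ i (ℓ i) = thetaV p ℓ := by
  have := hpos i
  exact tv_end _ _ (by omega) (by omega)

theorem tv_mid {p : ℕ} {ℓ : Fin p → ℕ} (i : Fin p) (a : ℕ) (h0 : a ≠ 0) (h : a < ℓ i) :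
    tv p ℓ i a = tX ℓ i ⟨a - 1, by omega⟩ := by
  unfold tv; rw [dif_neg h0, dif_pos h]

theorem tv_adj {p : ℕ} {ℓ : Fin p → ℕ} (i : Fin p) (a : ℕ) (h : a < ℓ i) :
    (thetaGraph p ℓ).Adj (tv p ℓ i a) (tv p ℓ i (a + 1)) := by
  have hi := i.2
  unfold thetaGraph
  rw [SimpleGraph.fromRel_adj]
  by_cases h0 : a = 0
  · subst h0
    rw [tv_zero]
    by_cases h1 : 1 < ℓ i
    · rw [tv_mid i (0+1) (by omega) (by omega)]
      refine ⟨ne_of_key ?_, Or.inl (Or.inl ⟨rfl, rfl⟩)⟩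
      rw [tkey_U, tkey_X]; simp
    · rw [tv_end i (0+1) (by omega) (by omega)]
      refine ⟨ne_of_key ?_, Or.inl ⟨rfl, rfl, i, by omega⟩⟩
      rw [tkey_U, tkey_V]; simp
  · by_cases h1 : a + 1 < ℓ i
    · rw [tv_mid i a h0 h, tv_mid i (a+1) (by omega) h1]
      refine ⟨ne_of_key ?_, Or.inl ⟨rfl, ?_⟩⟩
      · rw [tkey_X, tkey_X]; simp; omega
      · show a - 1 + 1 = a + 1 - 1
        omega
    · rw [tv_mid i a h0 h, tv_end i (a+1) (by omega) h1]
      refine ⟨ne_of_key ?_, Or.inr (Or.inr ⟨rfl, ?_⟩)⟩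
      · rw [tkey_X, tkey_V]; simp; omega
      · show a - 1 + 2 = ℓ i
        omega

theorem tv_dist {p : ℕ} {ℓ : Fin p → ℕ} (i : Fin p) (a d : ℕ) (h : a + d ≤ ℓ i) :
    (thetaGraph p ℓ).edist (tv p ℓ i a) (tv p ℓ i (a + d)) ≤ (d : ℕ∞) := by
  induction d with
  | zero => simp
  | succ d ih =>
    have h1 := ih (by omega)
    have h2 : (thetaGraph p ℓ).edist (tv p ℓ i (a + d)) (tv p ℓ i (a + (d + 1))) = 1 :=
      SimpleGraph.edist_eq_one_iff_adj.2 (tv_adj i (a + d) (by omega))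
    calc _ ≤ _ + _ := SimpleGraph.edist_triangle (v := tv p ℓ i (a + d))
      _ ≤ (d : ℕ∞) + 1 := by rw [h2]; gcongr
      _ = _ := by push_cast; rfl

theorem tv_distU {p : ℕ} {ℓ : Fin p → ℕ} (i : Fin p) (a : ℕ) (h : a ≤ ℓ i) :
    (thetaGraph p ℓ).edist (thetaU p ℓ) (tv p ℓ i a) ≤ (a : ℕ∞) := by
  have := tv_dist (ℓ := ℓ) i 0 a (by omega)
  rwa [tv_zero, zero_add] at this

theorem tv_distV {p : ℕ} {ℓ : Fin p → ℕ} (hpos : ∀ i, 1 ≤ ℓ i) (i : Fin p) (a d : ℕ)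
    (h : a + d = ℓ i) :
    (thetaGraph p ℓ).edist (tv p ℓ i a) (thetaV p ℓ) ≤ (d : ℕ∞) := by
  have := tv_dist (ℓ := ℓ) i a d (by omega)
  rwa [h, tv_last hpos] at this

section fwd

variable {p : ℕ} {ℓ : Fin p → ℕ} {π : ThetaVert p ℓ → ℕ}

theorem tv_inj {i : Fin p} {a b : ℕ} (hab : a < b) (hb : b ≤ ℓ i) :
    tv p ℓ i a ≠ tv p ℓ i b := by
  have hi := i.2
  apply ne_of_key
  by_cases h0 : a = 0
  · subst h0
    rw [tv_zero, tkey_U]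
    by_cases h1 : b < ℓ i
    · rw [tv_mid i b (by omega) h1, tkey_X]; simp
    · rw [tv_end i b (by omega) h1, tkey_V]; simp
  · rw [tv_mid i a (by omega) (by omega), tkey_X]
    by_cases h1 : b < ℓ i
    · rw [tv_mid i b (by omega) h1, tkey_X]; simp; omega
    · rw [tv_end i b (by omega) h1, tkey_V]; simp; omega

theorem tv_ne {i j : Fin p} (hij : i ≠ j) {a b : ℕ} (ha0 : a ≠ 0) (ha : a < ℓ i) :
    tv p ℓ i a ≠ tv p ℓ j b := by
  have hi := i.2
  apply ne_of_key
  rw [tv_mid i a ha0 ha, tkey_X]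
  by_cases h0 : b = 0
  · subst h0
    rw [tv_zero, tkey_U]; simp
  · by_cases h1 : b < ℓ j
    · rw [tv_mid j b h0 h1, tkey_X]; simp; omega
    · rw [tv_end j b h0 h1, tkey_V]; simp; omega

theorem same_path (hπ : IsPackingColoring (thetaGraph p ℓ) 4 π) (i : Fin p) (a b : ℕ)
    (hab : a < b) (hb : b ≤ ℓ i) (h : π (tv p ℓ i a) = π (tv p ℓ i b)) :
    π (tv p ℓ i a) + a < b := by
  have h1 := hπ.2 _ _ (tv_inj hab hb) h
  have h2 := tv_dist (ℓ := ℓ) i a (b - a) (by omega)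
  rw [show a + (b - a) = b by omega] at h2
  have h3 := lt_of_lt_of_le h1 h2
  have h4 : π (tv p ℓ i a) < b - a := by exact_mod_cast h3
  omega

theorem crossU (hπ : IsPackingColoring (thetaGraph p ℓ) 4 π) (i j : Fin p) (hij : i ≠ j)
    (a b : ℕ) (ha0 : a ≠ 0) (ha : a < ℓ i) (hb : b ≤ ℓ j)
    (h : π (tv p ℓ i a) = π (tv p ℓ j b)) :
    π (tv p ℓ i a) < a + b := by
  have h1 := hπ.2 _ _ (tv_ne hij ha0 ha) h
  have h2 := tv_distU (ℓ := ℓ) i a (by omega)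
  rw [SimpleGraph.edist_comm] at h2
  have h3 := tv_distU (ℓ := ℓ) j b hb
  have h4 := lt_of_lt_of_le h1
    ((SimpleGraph.edist_triangle (v := thetaU p ℓ)).trans (add_le_add h2 h3))
  exact_mod_cast h4

theorem crossV (hpos : ∀ i, 1 ≤ ℓ i)
    (hπ : IsPackingColoring (thetaGraph p ℓ) 4 π) (i j : Fin p) (hij : i ≠ j)
    (a b : ℕ) (ha0 : a ≠ 0) (ha : a < ℓ i) (hb : b ≤ ℓ j)
    (h : π (tv p ℓ i a) = π (tv p ℓ j b)) :
    π (tv p ℓ i a) < (ℓ i - a) + (ℓ j - b) := by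
  have h1 := hπ.2 _ _ (tv_ne hij ha0 ha) h
  have h2 := tv_distV (ℓ := ℓ) hpos i a (ℓ i - a) (by omega)
  have h3 := tv_distV (ℓ := ℓ) hpos j b (ℓ j - b) (by omega)
  rw [SimpleGraph.edist_comm] at h3
  have h4 := lt_of_lt_of_le h1
    ((SimpleGraph.edist_triangle (v := thetaV p ℓ)).trans (add_le_add h2 h3))
  exact_mod_cast h4

end fwd

/-- Path `c` of length `L` uses colour 4 close to `u`. -/
def TypF (c : ℕ → ℕ) (L : ℕ) : Prop := 7 ≤ L ∧ (c 1 = 4 ∨ c 2 = 4)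
/-- Strong use of colour 3 near the ends. -/
def TypS (c : ℕ → ℕ) (L : ℕ) : Prop :=
  3 ≤ L ∧ ((c 1 = 3 ∧ c (L - 2) = 3) ∨ (c 2 = 3 ∧ c (L - 1) = 3))
/-- Weak use of colour 3 near the ends. -/
def TypR (c : ℕ → ℕ) (L : ℕ) : Prop :=
  3 ≤ L ∧ (c 1 = 3 ∨ (c 2 = 3 ∧ (c (L - 1) = 3 ∨ c (L - 2) = 3)))

theorem TypS.r {c : ℕ → ℕ} {L : ℕ} (h : TypS c L) : TypR c L := by
  unfold TypS at h; unfold TypR; tauto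

/-- Local constraints on a path. -/
def PathOK (c : ℕ → ℕ) (L : ℕ) : Prop :=
  c 0 = 2 ∧ c L = 4 ∧ (∀ a, 1 ≤ c a ∧ c a ≤ 4) ∧
    ∀ a b, a < b → b ≤ L → c a = c b → c a + a < b

theorem four {n : ℕ} (h : 1 ≤ n ∧ n ≤ 4) : n = 1 ∨ n = 2 ∨ n = 3 ∨ n = 4 := by omega

theorem typ3 {c : ℕ → ℕ} (h : PathOK c 3) : TypS c 3 := by
  obtain ⟨h0, hL, hr, H⟩ := h
  have d1 := H 0 1; have d2 := H 0 2; have e1 := H 1 3; have e2 := H 2 3; have f := H 1 2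
  have := hr 1; have := hr 2
  simp only [TypS]
  norm_num
  omega

theorem typ4 {c : ℕ → ℕ} (h : PathOK c 4) : TypR c 4 := by
  obtain ⟨h0, hL, hr, H⟩ := h
  have d1 := H 0 1; have d2 := H 0 2; have e1 := H 1 4; have e2 := H 2 4; have e3 := H 3 4
  have f := H 1 2
  have := hr 1; have := hr 2
  simp only [TypR]
  norm_num
  omega

theorem typ7 {c : ℕ → ℕ} (h : PathOK c 7) : TypS c 7 ∨ TypF c 7 := by
  obtain ⟨h0, hL, hr, H⟩ := h
  by_contra hn
  simp only [TypS, TypF] at hn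
  norm_num at hn
  have k1 := fun a h => H a 1 h (by norm_num)
  have k2 := fun a h => H a 2 h (by norm_num)
  have k3 := fun a h => H a 3 h (by norm_num)
  have k4 := fun a h => H a 4 h (by norm_num)
  have k5 := fun a h => H a 5 h (by norm_num)
  have k6 := fun a h => H a 6 h (by norm_num)
  have k7 := fun a h => H a 7 h (by norm_num)
  simp only [Nat.forall_lt_succ_right, Nat.not_lt_zero, false_imp_iff, implies_true, true_and] at k1 k2 k3 k4 k5 k6 k7
  rcases four (hr 1) with g1 | g1 | g1 | g1 <;> simp [g1, h0, hL] at k1 k7 hn <;>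
  rcases four (hr 2) with g2 | g2 | g2 | g2 <;> simp [g1, g2, h0, hL] at k2 k7 hn <;>
  rcases four (hr 3) with g3 | g3 | g3 | g3 <;> simp [g1, g2, g3, h0, hL] at k3 k7 hn <;>
  rcases four (hr 4) with g4 | g4 | g4 | g4 <;> simp [g1, g2, g3, g4, h0, hL] at k4 k7 hn <;>
  rcases four (hr 5) with g5 | g5 | g5 | g5 <;> simp [g1, g2, g3, g4, g5, h0, hL] at k5 k7 hn <;>
  rcases four (hr 6) with g6 | g6 | g6 | g6 <;> simp [g1, g2, g3, g4, g5, g6, h0, hL] at k6 k7 hn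

theorem typ8 {c : ℕ → ℕ} (h : PathOK c 8) : TypR c 8 ∨ TypF c 8 := by
  obtain ⟨h0, hL, hr, H⟩ := h
  by_contra hn
  simp only [TypR, TypF] at hn
  norm_num at hn
  have k1 := fun a h => H a 1 h (by norm_num)
  have k2 := fun a h => H a 2 h (by norm_num)
  have k3 := fun a h => H a 3 h (by norm_num)
  have k4 := fun a h => H a 4 h (by norm_num)
  have k5 := fun a h => H a 5 h (by norm_num)
  have k6 := fun a h => H a 6 h (by norm_num)
  have k7 := fun a h => H a 7 h (by norm_num)
  have k8 := fun a h => H a 8 h (by norm_num)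
  simp only [Nat.forall_lt_succ_right, Nat.not_lt_zero, false_imp_iff, implies_true, true_and]
    at k1 k2 k3 k4 k5 k6 k7 k8
  rcases four (hr 1) with g1 | g1 | g1 | g1 <;> simp [g1, h0, hL] at k1 k8 hn <;>
  rcases four (hr 2) with g2 | g2 | g2 | g2 <;> simp [g1, g2, h0, hL] at k2 k8 hn <;>
  rcases four (hr 3) with g3 | g3 | g3 | g3 <;> simp [g1, g2, g3, h0, hL] at k3 k8 hn <;>
  rcases four (hr 4) with g4 | g4 | g4 | g4 <;> simp [g1, g2, g3, g4, h0, hL] at k4 k8 hn <;>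
  rcases four (hr 5) with g5 | g5 | g5 | g5 <;> simp [g1, g2, g3, g4, g5, h0, hL] at k5 k8 hn <;>
  rcases four (hr 6) with g6 | g6 | g6 | g6 <;>
    simp [g1, g2, g3, g4, g5, g6, h0, hL] at k6 k8 hn <;>
  rcases four (hr 7) with g7 | g7 | g7 | g7 <;>
    simp [g1, g2, g3, g4, g5, g6, g7, h0, hL] at k7 k8 hn

section fwd2

variable {p : ℕ} {ℓ : Fin p → ℕ} {π : ThetaVert p ℓ → ℕ}

theorem pathOK (hpos : ∀ i, 1 ≤ ℓ i) (hπ : IsPackingColoring (thetaGraph p ℓ) 4 π)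
    (hu : π (thetaU p ℓ) = 2) (hv : π (thetaV p ℓ) = 4) (i : Fin p) :
    PathOK (fun a => π (tv p ℓ i a)) (ℓ i) := by
  refine ⟨by simpa [tv_zero] using hu, by simpa [tv_last hpos] using hv, fun a => hπ.1 _, ?_⟩
  intro a b hab hb h
  exact same_path hπ i a b hab hb h

theorem noFF (hπ : IsPackingColoring (thetaGraph p ℓ) 4 π)
    (i j : Fin p) (hij : i ≠ j) (hi : TypF (fun a => π (tv p ℓ i a)) (ℓ i))
    (hj : TypF (fun a => π (tv p ℓ j a)) (ℓ j)) : False := by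
  obtain ⟨hi0, hi⟩ := hi
  obtain ⟨hj0, hj⟩ := hj
  simp only at hi hj
  rcases hi with hi | hi <;> rcases hj with hj | hj <;>
  · have := crossU hπ i j hij _ _ (by norm_num) (by omega) (by omega) (hi.trans hj.symm)
    omega

theorem noFs (hpos : ∀ i, 1 ≤ ℓ i) (hπ : IsPackingColoring (thetaGraph p ℓ) 4 π)
    (hv : π (thetaV p ℓ) = 4)
    (i j : Fin p) (hi : TypF (fun a => π (tv p ℓ i a)) (ℓ i)) (hj : ℓ j ≤ 2) : False := by
  obtain ⟨hi0, hi⟩ := hi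
  have hij : i ≠ j := by rintro rfl; omega
  simp only at hi
  have hj' : π (tv p ℓ j (ℓ j)) = 4 := by rw [tv_last hpos]; exact hv
  rcases hi with hi | hi <;>
  · have := crossU hπ i j hij _ _ (by norm_num) (by omega) le_rfl (hi.trans hj'.symm)
    omega

theorem noSR (hpos : ∀ i, 1 ≤ ℓ i) (hπ : IsPackingColoring (thetaGraph p ℓ) 4 π)
    (i j : Fin p) (hij : i ≠ j) (hi : TypS (fun a => π (tv p ℓ i a)) (ℓ i))
    (hj : TypR (fun a => π (tv p ℓ j a)) (ℓ j)) : False := by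
  obtain ⟨hi0, hi⟩ := hi
  obtain ⟨hj0, hj⟩ := hj
  simp only at hi hj
  rcases hi with ⟨hi, -⟩ | ⟨hi, hi'⟩
  · rcases hj with hj | ⟨hj, -⟩ <;>
    · have := crossU hπ i j hij _ _ (by norm_num) (by omega) (by omega) (hi.trans hj.symm)
      omega
  · rcases hj with hj | ⟨-, hj | hj⟩
    · have := crossU hπ i j hij _ _ (by norm_num) (by omega) (by omega) (hi.trans hj.symm)
      omega
    · have := crossV hpos hπ i j hij _ _ (by omega) (by omega) (by omega) (hi'.trans hj.symm)
      omega
    · have := crossV hpos hπ i j hij _ _ (by omega) (by omega) (by omega) (hi'.trans hj.symm)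
      omega

theorem pc1 {m : ℕ} (h : 1 ≤ pathCount p ℓ m) : ∃ i, ℓ i = m := by
  obtain ⟨i, hi⟩ := Finset.card_pos.1 h
  exact ⟨i, by simpa using hi⟩

theorem pc2 {m : ℕ} (h : 2 ≤ pathCount p ℓ m) : ∃ i j, i ≠ j ∧ ℓ i = m ∧ ℓ j = m := by
  obtain ⟨i, hi, j, hj, hij⟩ := Finset.one_lt_card.1 h
  exact ⟨i, j, hij, by simpa using hi, by simpa using hj⟩

theorem pc3 {m : ℕ} (h : 3 ≤ pathCount p ℓ m) :
    ∃ i j k, i ≠ j ∧ i ≠ k ∧ j ≠ k ∧ ℓ i = m ∧ ℓ j = m ∧ ℓ k = m := by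
  obtain ⟨i, j, k, hi, hj, hk, h1, h2, h3⟩ := Finset.two_lt_card_iff.1 h
  exact ⟨i, j, k, h1, h2, h3, by simpa using hi, by simpa using hj, by simpa using hk⟩

theorem ne_of_len {i j : Fin p} {a b : ℕ} (hi : ℓ i = a) (hj : ℓ j = b) (h : a ≠ b) : i ≠ j := by
  rintro rfl; omega

theorem forward (hpos : ∀ i, 1 ≤ ℓ i)
    (hπ : IsPackingColoring (thetaGraph p ℓ) 4 π)
    (hu : π (thetaU p ℓ) = 2) (hv : π (thetaV p ℓ) = 4) (n : ℕ → ℕ) (hn : n = pathCount p ℓ) :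
    (n 3 = 0 ∧ n 7 = 0) ∨ (n 3 = 0 ∧ n 4 = 0 ∧ n 7 ≤ 1 ∧ n 8 = 0) ∨
    (n 3 ≤ 1 ∧ n 4 = 0 ∧ n 7 = 0 ∧ n 8 = 0) ∨
    (n 1 = 0 ∧ n 2 = 0 ∧ n 3 = 0 ∧ n 7 ≤ 1) ∨
    (n 1 = 0 ∧ n 2 = 0 ∧ n 3 = 0 ∧ n 4 = 0 ∧ n 7 = 2 ∧ n 8 = 0) ∨
    (n 1 = 0 ∧ n 2 = 0 ∧ n 3 ≤ 1 ∧ n 4 = 0 ∧ n 7 + n 8 ≤ 1) := by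
  obtain ⟨S, hS⟩ : ∃ S : Fin p → Prop, S = fun i => TypS (fun a => π (tv p ℓ i a)) (ℓ i) :=
    ⟨_, rfl⟩
  obtain ⟨R, hR⟩ : ∃ R : Fin p → Prop, R = fun i => TypR (fun a => π (tv p ℓ i a)) (ℓ i) :=
    ⟨_, rfl⟩
  obtain ⟨F, hF⟩ : ∃ F : Fin p → Prop, F = fun i => TypF (fun a => π (tv p ℓ i a)) (ℓ i) :=
    ⟨_, rfl⟩
  have ok := pathOK hpos hπ hu hv
  have t3 : ∀ i, ℓ i = 3 → S i := fun i hi => by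
    have := ok i
    rw [hS]; simp only; rw [hi] at this ⊢; exact typ3 this
  have t4 : ∀ i, ℓ i = 4 → R i := fun i hi => by
    have := ok i
    rw [hR]; simp only; rw [hi] at this ⊢; exact typ4 this
  have t7 : ∀ i, ℓ i = 7 → S i ∨ F i := fun i hi => by
    have := ok i
    rw [hS, hF]; simp only; rw [hi] at this ⊢; exact typ7 this
  have t8 : ∀ i, ℓ i = 8 → R i ∨ F i := fun i hi => by
    have := ok i
    rw [hR, hF]; simp only; rw [hi] at this ⊢; exact typ8 this
  have ff : ∀ i j, i ≠ j → F i → F j → False := fun i j hij hi hj => by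
    rw [hF] at hi hj; exact noFF hπ i j hij hi hj
  have sr : ∀ i j, i ≠ j → S i → R j → False := fun i j hij hi hj => by
    rw [hS] at hi; rw [hR] at hj; exact noSR hpos hπ i j hij hi hj
  have ss : ∀ i j, i ≠ j → S i → S j → False := fun i j hij hi hj => by
    refine sr i j hij hi ?_
    rw [hS] at hj; rw [hR]; exact hj.r
  have fs : ∀ i, F i → n 1 = 0 ∧ n 2 = 0 := fun i hi => by
    rw [hF] at hi
    rw [hn]
    constructor
    · by_contra h
      obtain ⟨j, hj⟩ := pc1 (Nat.pos_of_ne_zero h)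
      exact noFs hpos hπ hv i j hi (by omega)
    · by_contra h
      obtain ⟨j, hj⟩ := pc1 (Nat.pos_of_ne_zero h)
      exact noFs hpos hπ hv i j hi (by omega)
  clear hS hR hF ok
  have g1 : ∀ m, 1 ≤ n m → ∃ i, ℓ i = m := fun m h => pc1 (hn ▸ h)
  have g2 : ∀ m, 2 ≤ n m → ∃ i j, i ≠ j ∧ ℓ i = m ∧ ℓ j = m := fun m h => pc2 (hn ▸ h)
  have g3 : ∀ m, 3 ≤ n m → ∃ i j k, i ≠ j ∧ i ≠ k ∧ j ≠ k ∧ ℓ i = m ∧ ℓ j = m ∧ ℓ k = m :=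
    fun m h => pc3 (hn ▸ h)
  have f33 : n 3 ≤ 1 := by
    by_contra h
    obtain ⟨i, j, hij, hi, hj⟩ := g2 3 (by omega)
    exact ss i j hij (t3 i hi) (t3 j hj)
  have f34 : n 3 = 0 ∨ n 4 = 0 := by
    by_contra h
    obtain ⟨i, hi⟩ := g1 3 (by omega)
    obtain ⟨j, hj⟩ := g1 4 (by omega)
    exact sr i j (ne_of_len hi hj (by norm_num)) (t3 i hi) (t4 j hj)
  have f37 : n 3 = 0 ∨ n 7 = 0 ∨ (n 1 = 0 ∧ n 2 = 0) := by
    by_contra h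
    obtain ⟨i, hi⟩ := g1 3 (by omega)
    obtain ⟨j, hj⟩ := g1 7 (by omega)
    rcases t7 j hj with hh | hh
    · exact ss i j (ne_of_len hi hj (by norm_num)) (t3 i hi) hh
    · have := fs j hh
      omega
  have f38 : n 3 = 0 ∨ n 8 = 0 ∨ (n 1 = 0 ∧ n 2 = 0) := by
    by_contra h
    obtain ⟨i, hi⟩ := g1 3 (by omega)
    obtain ⟨j, hj⟩ := g1 8 (by omega)
    rcases t8 j hj with hh | hh
    · exact sr i j (ne_of_len hi hj (by norm_num)) (t3 i hi) hh
    · have := fs j hh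
      omega
  have f377 : n 3 = 0 ∨ n 7 ≤ 1 := by
    by_contra h
    obtain ⟨i, hi⟩ := g1 3 (by omega)
    obtain ⟨j, k, hjk, hj, hk⟩ := g2 7 (by omega)
    have a1 := ss i j (ne_of_len hi hj (by norm_num)) (t3 i hi)
    have a2 := ss i k (ne_of_len hi hk (by norm_num)) (t3 i hi)
    exact ff j k hjk ((t7 j hj).resolve_left a1) ((t7 k hk).resolve_left a2)
  have f388 : n 3 = 0 ∨ n 8 ≤ 1 := by
    by_contra h
    obtain ⟨i, hi⟩ := g1 3 (by omega)
    obtain ⟨j, k, hjk, hj, hk⟩ := g2 8 (by omega)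
    have a1 := sr i j (ne_of_len hi hj (by norm_num)) (t3 i hi)
    have a2 := sr i k (ne_of_len hi hk (by norm_num)) (t3 i hi)
    exact ff j k hjk ((t8 j hj).resolve_left a1) ((t8 k hk).resolve_left a2)
  have f378 : n 3 = 0 ∨ n 7 = 0 ∨ n 8 = 0 := by
    by_contra h
    obtain ⟨i, hi⟩ := g1 3 (by omega)
    obtain ⟨j, hj⟩ := g1 7 (by omega)
    obtain ⟨k, hk⟩ := g1 8 (by omega)
    have a1 := ss i j (ne_of_len hi hj (by norm_num)) (t3 i hi)
    have a2 := sr i k (ne_of_len hi hk (by norm_num)) (t3 i hi)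
    exact ff j k (ne_of_len hj hk (by norm_num)) ((t7 j hj).resolve_left a1)
      ((t8 k hk).resolve_left a2)
  have f777 : n 7 ≤ 2 := by
    by_contra h
    obtain ⟨i, j, k, hij, hik, hjk, hi, hj, hk⟩ := g3 7 (by omega)
    rcases t7 i hi with a | a <;> rcases t7 j hj with b | b <;> rcases t7 k hk with c | c <;>
      first
        | exact ss i j hij a b
        | exact ss i k hik a c
        | exact ss j k hjk b c
        | exact ff i j hij a b
        | exact ff i k hik a c
        | exact ff j k hjk b c
  have f77 : n 7 ≤ 1 ∨ (n 1 = 0 ∧ n 2 = 0 ∧ n 4 = 0 ∧ n 8 = 0) := by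
    by_contra h
    obtain ⟨i, j, hij, hi, hj⟩ := g2 7 (by omega)
    have hSF : ∃ i j, i ≠ j ∧ ℓ i = 7 ∧ ℓ j = 7 ∧ S i ∧ F j := by
      rcases t7 i hi with a | a <;> rcases t7 j hj with b | b
      · exact (ss i j hij a b).elim
      · exact ⟨i, j, hij, hi, hj, a, b⟩
      · exact ⟨j, i, hij.symm, hj, hi, b, a⟩
      · exact (ff i j hij a b).elim
    obtain ⟨i, j, hij, hi, hj, a, b⟩ := hSF
    have h12 := fs j b
    by_cases h4 : n 4 = 0
    · obtain ⟨k, hk⟩ := g1 8 (by omega)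
      rcases t8 k hk with c | c
      · exact sr i k (ne_of_len hi hk (by norm_num)) a c
      · exact ff j k (ne_of_len hj hk (by norm_num)) b c
    · obtain ⟨k, hk⟩ := g1 4 (by omega)
      exact sr i k (ne_of_len hi hk (by norm_num)) a (t4 k hk)
  have f7 : n 7 = 0 ∨ (n 1 = 0 ∧ n 2 = 0) ∨ (n 4 = 0 ∧ n 8 = 0) := by
    by_contra h
    obtain ⟨i, hi⟩ := g1 7 (by omega)
    rcases t7 i hi with a | a
    · by_cases h4 : n 4 = 0
      · obtain ⟨k, hk⟩ := g1 8 (by omega)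
        rcases t8 k hk with c | c
        · exact sr i k (ne_of_len hi hk (by norm_num)) a c
        · have := fs k c
          omega
      · obtain ⟨k, hk⟩ := g1 4 (by omega)
        exact sr i k (ne_of_len hi hk (by norm_num)) a (t4 k hk)
    · have := fs i a
      omega
  clear hn
  omega

end fwd2

section bwd

variable {p : ℕ} {ℓ : Fin p → ℕ}

/-- Lower bound on the distance to `u`. -/
def dU (m : ℕ) : ThetaVert p ℓ → ℕ
  | Sum.inl false => 0
  | Sum.inl true => m
  | Sum.inr ⟨i, j⟩ => min ((j : ℕ) + 1) (ℓ i - ((j : ℕ) + 1) + m)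

/-- Lower bound on the distance to `v`. -/
def dV (m : ℕ) : ThetaVert p ℓ → ℕ
  | Sum.inl false => m
  | Sum.inl true => 0
  | Sum.inr ⟨i, j⟩ => min (ℓ i - ((j : ℕ) + 1)) ((j : ℕ) + 1 + m)

/-- Necessary condition for a walk of length `n`. -/
def Near (m n : ℕ) (x y : ThetaVert p ℓ) : Prop :=
  dU m x + dU m y ≤ n ∨ dV m x + dV m y ≤ n ∨
    ∃ (i : Fin p) (j j' : Fin (ℓ i - 1)), x = tX ℓ i j ∧ y = tX ℓ i j' ∧
      (j : ℕ) ≤ j' + n ∧ (j' : ℕ) ≤ j + n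

theorem rel_cases {x z : ThetaVert p ℓ} (h : thetaRel p ℓ x z) :
    (x = thetaU p ℓ ∧ z = thetaV p ℓ ∧ ∃ i, ℓ i = 1) ∨
    (∃ i j, x = thetaU p ℓ ∧ z = tX ℓ i j ∧ (j : ℕ) = 0) ∨
    (∃ i j, x = thetaV p ℓ ∧ z = tX ℓ i j ∧ (j : ℕ) + 2 = ℓ i) ∨
    (∃ i j j', x = tX ℓ i j ∧ z = tX ℓ i j' ∧ (j : ℕ) + 1 = j') := by
  rcases x with a | ⟨i, j⟩ <;> rcases z with b | ⟨i', j'⟩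
  · obtain ⟨rfl, rfl, h⟩ := h
    exact Or.inl ⟨rfl, rfl, h⟩
  · rcases h with ⟨rfl, h⟩ | ⟨rfl, h⟩
    · exact Or.inr (Or.inl ⟨i', j', rfl, rfl, h⟩)
    · exact Or.inr (Or.inr (Or.inl ⟨i', j', rfl, rfl, h⟩))
  · exact h.elim
  · obtain ⟨h1, h2⟩ := h
    obtain rfl : i = i' := Fin.ext h1
    exact Or.inr (Or.inr (Or.inr ⟨i, j, j', rfl, rfl, h2⟩))

theorem dU_U (m : ℕ) : dU m (thetaU p ℓ) = 0 := rfl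
theorem dU_V (m : ℕ) : dU m (thetaV p ℓ) = m := rfl
theorem dV_U (m : ℕ) : dV m (thetaU p ℓ) = m := rfl
theorem dV_V (m : ℕ) : dV m (thetaV p ℓ) = 0 := rfl
theorem dU_X (m : ℕ) (i : Fin p) (j : Fin (ℓ i - 1)) :
    dU m (tX ℓ i j) = min ((j : ℕ) + 1) (ℓ i - ((j : ℕ) + 1) + m) := rfl
theorem dV_X (m : ℕ) (i : Fin p) (j : Fin (ℓ i - 1)) :
    dV m (tX ℓ i j) = min (ℓ i - ((j : ℕ) + 1)) ((j : ℕ) + 1 + m) := rfl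

theorem tX_inj {i i' : Fin p} {j : Fin (ℓ i - 1)} {j' : Fin (ℓ i' - 1)}
    (h : tX ℓ i j = tX ℓ i' j') : i = i' ∧ (j : ℕ) = j' := by
  have := congrArg tkey h
  rw [tkey_X, tkey_X] at this
  simp at this
  exact ⟨Fin.ext this.1, this.2⟩

theorem U_ne_X {i : Fin p} {j : Fin (ℓ i - 1)} : thetaU p ℓ ≠ tX ℓ i j := by
  apply ne_of_key; rw [tkey_U, tkey_X]; simp
theorem V_ne_X {i : Fin p} {j : Fin (ℓ i - 1)} : thetaV p ℓ ≠ tX ℓ i j := by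
  have := i.2
  apply ne_of_key; rw [tkey_V, tkey_X]; simp; omega

theorem near_step {m n : ℕ} (hm : ∀ i, m ≤ ℓ i) {x z y : ThetaVert p ℓ}
    (h : thetaRel p ℓ x z ∨ thetaRel p ℓ z x) (hzy : Near m n z y) : Near m (n + 1) x y := by
  have key : dU m x ≤ dU m z + 1 ∧ dV m x ≤ dV m z + 1 := by
    rcases h with h | h <;> rcases rel_cases h with ⟨rfl, rfl, i, hi⟩ | ⟨i, j, rfl, rfl, hj⟩ |
      ⟨i, j, rfl, rfl, hj⟩ | ⟨i, j, j', rfl, rfl, hj⟩ <;>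
    · have := hm i
      try have := j.2
      simp only [dU_U, dU_V, dV_U, dV_V, dU_X, dV_X]
      omega
  rcases hzy with h1 | h1 | ⟨i, j, j', rfl, rfl, h1, h2⟩
  · left; omega
  · right; left; omega
  · have b1 := j.2
    have b2 := j'.2
    have := hm i
    rcases h with h | h <;> rcases rel_cases h with ⟨e, e', i', hi⟩ | ⟨i', k, e, e', hj⟩ |
      ⟨i', k, e, e', hj⟩ | ⟨i', k, k', e, e', hj⟩
    · exact (V_ne_X e'.symm).elim
    · obtain ⟨rfl, e2⟩ := tX_inj e'
      left; subst e; rw [dU_U, dU_X]; omega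
    · obtain ⟨rfl, e2⟩ := tX_inj e'
      right; left; subst e; rw [dV_V, dV_X]; omega
    · obtain ⟨rfl, e2⟩ := tX_inj e'
      right; right; exact ⟨i, k, j', e, rfl, by omega, by omega⟩
    · exact (U_ne_X e.symm).elim
    · exact (U_ne_X e.symm).elim
    · exact (V_ne_X e.symm).elim
    · obtain ⟨rfl, e2⟩ := tX_inj e
      right; right; exact ⟨i, k', j', e', rfl, by omega, by omega⟩

theorem near_refl {m : ℕ} (x : ThetaVert p ℓ) : Near m 0 x x := by
  rcases x with (_ | _) | ⟨i, j⟩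
  · left; exact le_rfl
  · right; left; exact le_rfl
  · right; right; exact ⟨i, j, j, rfl, rfl, by omega, by omega⟩

theorem near_walk {m : ℕ} (hm : ∀ i, m ≤ ℓ i) {x y : ThetaVert p ℓ}
    (w : (thetaGraph p ℓ).Walk x y) : Near m w.length x y := by
  induction w with
  | nil => exact near_refl _
  | cons h w ih =>
    rw [SimpleGraph.Walk.length_cons]
    exact near_step hm ((SimpleGraph.fromRel_adj _ _ _).1 h).2 ih

theorem near_mono {m n n' : ℕ} {x y : ThetaVert p ℓ} (h : Near m n x y) (hn : n ≤ n') :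
    Near m n' x y := by
  rcases h with h | h | ⟨i, j, j', h0, h0', h1, h2⟩
  · left; omega
  · right; left; omega
  · right; right; exact ⟨i, j, j', h0, h0', by omega, by omega⟩

theorem lt_edist {m k : ℕ} (hm : ∀ i, m ≤ ℓ i) {x y : ThetaVert p ℓ}
    (h : ¬ Near m k x y) : (k : ℕ∞) < (thetaGraph p ℓ).edist x y := by
  by_contra hlt
  rw [not_lt] at hlt
  have hne : (thetaGraph p ℓ).edist x y ≠ ⊤ := fun e => by
    rw [e] at hlt; exact absurd hlt (by simp)
  obtain ⟨w, hw⟩ := SimpleGraph.exists_walk_of_edist_ne_top hne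
  rw [← hw] at hlt
  exact h (near_mono (near_walk hm w) (by exact_mod_cast hlt))

/-- Good colourings of a single path of length `L`. -/
def Good (c : ℕ → ℕ) (L q r : ℕ) : Prop :=
  c 0 = 2 ∧ c L = 4 ∧ (∀ a, 1 ≤ c a ∧ c a ≤ 4) ∧
  (∀ a b, a < b → b ≤ L → c a = c b → c a + a < b) ∧
  ∀ a, 0 < a → a < L → (c a = 2 → 3 ≤ a ∧ a + 2 ≤ L) ∧ (c a = 3 → 2 ≤ a ∧ a + q ≤ L) ∧
    (c a = 4 → r ≤ a ∧ a + 5 ≤ L)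

/-- Colouring of the theta graph from colourings of its paths. -/
def glue (c : Fin p → ℕ → ℕ) : ThetaVert p ℓ → ℕ
  | Sum.inl false => 2
  | Sum.inl true => 4
  | Sum.inr ⟨i, j⟩ => c i ((j : ℕ) + 1)

theorem glue_spec {m : ℕ} (hm1 : 1 ≤ m) (hm : ∀ i, m ≤ ℓ i) (c : Fin p → ℕ → ℕ) (q r : Fin p → ℕ)
    (hg : ∀ i, Good (c i) (ℓ i) (q i) (r i)) (hq : ∀ i, 1 ≤ q i) (hr : ∀ i, 2 ≤ r i)
    (hqq : ∀ i j, i ≠ j → 4 ≤ q i + q j) (hrr : ∀ i j, i ≠ j → 5 ≤ r i + r j)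
    (hmr : ∀ i, 5 ≤ m + r i) :
    IsPackingColoring (thetaGraph p ℓ) 4 (glue c) := by
  have hX : ∀ i (j : Fin (ℓ i - 1)), glue c (tX ℓ i j) = c i (j + 1) := fun _ _ => rfl
  have hU : glue c (thetaU p ℓ) = 2 := rfl
  have hV : glue c (thetaV p ℓ) = 4 := rfl
  have hcase : ∀ x : ThetaVert p ℓ, x = thetaU p ℓ ∨ x = thetaV p ℓ ∨ ∃ i j, x = tX ℓ i j := by
    rintro ((_ | _) | ⟨i, j⟩)
    · exact Or.inl rfl
    · exact Or.inr (Or.inl rfl)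
    · exact Or.inr (Or.inr ⟨i, j, rfl⟩)
  constructor
  · intro x
    rcases hcase x with rfl | rfl | ⟨i, j, rfl⟩
    · rw [hU]; omega
    · rw [hV]; omega
    · rw [hX]; exact (hg i).2.2.1 _
  · intro x y hxy hc
    apply lt_edist hm
    intro hN
    have sUX : ∀ i (j : Fin (ℓ i - 1)), c i (j + 1) = 2 →
        ¬ (dU m (tX ℓ i j) ≤ 2) ∧ ¬ (m + dV m (tX ℓ i j) ≤ 2) := by
      intro i j h
      have := ((hg i).2.2.2.2 (j + 1) (by omega) (by omega)).1 h
      have := hm i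
      rw [dU_X, dV_X]
      omega
    have sVX : ∀ i (j : Fin (ℓ i - 1)), c i (j + 1) = 4 →
        ¬ (m + dU m (tX ℓ i j) ≤ 4) ∧ ¬ (dV m (tX ℓ i j) ≤ 4) := by
      intro i j h
      have := ((hg i).2.2.2.2 (j + 1) (by omega) (by omega)).2.2 h
      have := hm i
      have := hmr i
      have := hr i
      rw [dU_X, dV_X]
      omega
    rcases hcase x with rfl | rfl | ⟨i, j, rfl⟩ <;> rcases hcase y with rfl | rfl | ⟨i', j', rfl⟩
    · exact hxy rfl
    · rw [hU, hV] at hc; omega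
    · rw [hU, hX] at hc
      have := sUX i' j' hc.symm
      rcases hN with h | h | ⟨_, _, _, h, _⟩
      · rw [hU, dU_U] at h; omega
      · rw [hU, dV_U] at h; omega
      · exact U_ne_X h
    · rw [hU, hV] at hc; omega
    · exact hxy rfl
    · rw [hV, hX] at hc
      have := sVX i' j' hc.symm
      rcases hN with h | h | ⟨_, _, _, h, _⟩
      · rw [hV, dU_V] at h; omega
      · rw [hV, dV_V] at h; omega
      · exact V_ne_X h
    · rw [hX, hU] at hc
      have := sUX i j hc
      rcases hN with h | h | ⟨_, _, _, _, h, _⟩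
      · rw [hX, hc, dU_U] at h; omega
      · rw [hX, hc, dV_U] at h; omega
      · exact U_ne_X h
    · rw [hX, hV] at hc
      have := sVX i j hc
      rcases hN with h | h | ⟨_, _, _, _, h, _⟩
      · rw [hX, hc, dU_V] at h; omega
      · rw [hX, hc, dV_V] at h; omega
      · exact V_ne_X h
    · rw [hX, hX] at hc
      rw [hX] at hN
      have b1 := j.2
      have b2 := j'.2
      have r1 := (hg i).2.2.1 (j + 1)
      have s1 := (hg i).2.2.2.2 (j + 1) (by omega) (by omega)
      have s2 := (hg i').2.2.2.2 (j' + 1) (by omega) (by omega)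
      have m1 := hm i
      have m2 := hm i'
      have q1 := hq i
      have q2 := hq i'
      have e1 := hr i
      have e2 := hr i'
      have x1 := hmr i
      have x2 := hmr i'
      by_cases hii : i = i'
      · subst hii
        have hne : (j : ℕ) ≠ j' := fun e => hxy (by rw [Fin.ext e])
        have p1 := (hg i).2.2.2.1 (j + 1) (j' + 1)
        have p2 := (hg i).2.2.2.1 (j' + 1) (j + 1)
        rcases hN with h | h | ⟨i2, k, k', h, h', g1, g2⟩
        · rw [dU_X, dU_X] at h
          omega
        · rw [dV_X, dV_X] at h
          omega
        · have a1 := (tX_inj h).2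
          have a2 := (tX_inj h').2
          omega
      · have y1 := hqq i i' hii
        have y2 := hrr i i' hii
        rcases hN with h | h | ⟨i2, k, k', h, h', g1, g2⟩
        · rw [dU_X, dU_X] at h
          omega
        · rw [dV_X, dV_X] at h
          omega
        · exact hii ((tX_inj h).1.trans (tX_inj h').1.symm)

end bwd

/-- Periodic colouring. -/
def perc (a : ℕ) : ℕ := if a % 4 = 0 then 2 else if a % 4 = 2 then 3 else 1

/-- Special colouring for lengths 3 and 7 with colour 3 next to `v`. -/
def spS (L a : ℕ) : ℕ := if a = L then 4 else perc a

/-- Special colouring for lengths 7 and 8 with colour 4 close to `u`. -/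
def spF (L a : ℕ) : ℕ :=
  if a = 0 then 2 else if a = L then 4 else if a + 4 = L then 3 else if a + 2 = L then 2
  else if a = 2 then 4 else 1

/-- Neutral colouring. -/
def neu (L a : ℕ) : ℕ :=
  if a = L then 4
  else if L % 4 = 1 then (if a + 2 = L then 2 else if a + 1 = L ∧ a ≠ 0 then 1 else perc a)
  else if L % 4 = 2 then perc a
  else if L % 4 = 3 then
    (if a + 6 = L then 4 else if a + 5 = L then 1 else if a + 4 = L then 3 else
     if a + 3 = L then 1 else if a + 2 = L then 2 else if a + 1 = L then 1 else perc a)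
  else if L ≤ 8 then perc a
  else (if a + 6 = L then 4 else if a + 5 = L then 2 else if a + 4 = L then 1 else
     if a + 3 = L then 3 else if a + 2 = L then 2 else if a + 1 = L then 1 else perc a)

theorem good_S {L : ℕ} (h : L = 3 ∨ L = 7) : Good (spS L) L 1 4 := by
  refine ⟨?_, ?_, ?_, ?_, ?_⟩
  · rcases h with rfl | rfl <;> rfl
  · rcases h with rfl | rfl <;> rfl
  · intro a; unfold spS perc; split_ifs <;> omega
  · intro a b; unfold spS perc; split_ifs <;> omega
  · intro a; unfold spS perc; split_ifs <;> omega

theorem good_F {L : ℕ} (h : L = 7 ∨ L = 8) : Good (spF L) L 3 2 := by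
  refine ⟨?_, ?_, ?_, ?_, ?_⟩
  · rcases h with rfl | rfl <;> rfl
  · rcases h with rfl | rfl <;> rfl
  · intro a; unfold spF; split_ifs <;> omega
  · intro a b; unfold spF; split_ifs <;> omega
  · intro a; unfold spF; split_ifs <;> omega

/-- Description of the periodic colouring. -/
theorem perc_spec (a : ℕ) : (a % 4 = 0 ∧ perc a = 2) ∨ (a % 4 = 1 ∧ perc a = 1) ∨
    (a % 4 = 2 ∧ perc a = 3) ∨ (a % 4 = 3 ∧ perc a = 1) := by
  unfold perc; split_ifs <;> omega

theorem neu_last (L : ℕ) : neu L L = 4 := by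
  unfold neu; rw [if_pos rfl]

theorem neu_spec1 {L : ℕ} (hL : L % 4 = 1) (a : ℕ) : (a = L ∧ neu L a = 4) ∨
    (a + 2 = L ∧ neu L a = 2) ∨ (a + 1 = L ∧ a ≠ 0 ∧ neu L a = 1) ∨
    (a ≠ L ∧ (a + 1 ≠ L ∨ a = 0) ∧ a + 2 ≠ L ∧ neu L a = perc a) := by
  by_cases ha : a = L
  · subst ha; exact Or.inl ⟨rfl, neu_last a⟩
  · obtain ⟨v, hv⟩ : ∃ v, v = neu L a := ⟨_, rfl⟩
    rw [← hv]
    unfold neu at hv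
    rw [if_neg ha, if_pos hL] at hv
    split_ifs at hv <;> omega

theorem neu_spec2 {L : ℕ} (hL : L % 4 = 2 ∨ (L % 4 = 0 ∧ L ≤ 8)) (a : ℕ) :
    (a = L ∧ neu L a = 4) ∨ (a ≠ L ∧ neu L a = perc a) := by
  by_cases ha : a = L
  · subst ha; exact Or.inl ⟨rfl, neu_last a⟩
  · refine Or.inr ⟨ha, ?_⟩
    unfold neu
    rw [if_neg ha, if_neg (by omega)]
    rcases hL with hL | ⟨hL, h8⟩
    · rw [if_pos hL]
    · rw [if_neg (by omega), if_neg (by omega), if_pos h8]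

theorem neu_spec3 {L : ℕ} (hL : L % 4 = 3) (a : ℕ) : (a = L ∧ neu L a = 4) ∨
    (a + 6 = L ∧ neu L a = 4) ∨ (a + 4 = L ∧ neu L a = 3) ∨ (a + 2 = L ∧ neu L a = 2) ∨
    ((a + 1 = L ∨ a + 3 = L ∨ a + 5 = L) ∧ neu L a = 1) ∨
    ((a + 6 < L ∨ L < a) ∧ neu L a = perc a) := by
  by_cases ha : a = L
  · subst ha; exact Or.inl ⟨rfl, neu_last a⟩
  · obtain ⟨v, hv⟩ : ∃ v, v = neu L a := ⟨_, rfl⟩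
    rw [← hv]
    unfold neu at hv
    rw [if_neg ha, if_neg (by omega), if_neg (by omega), if_pos hL] at hv
    split_ifs at hv <;> omega

theorem neu_spec0 {L : ℕ} (hL : L % 4 = 0) (h8 : 8 < L) (a : ℕ) : (a = L ∧ neu L a = 4) ∨
    (a + 6 = L ∧ neu L a = 4) ∨ (a + 3 = L ∧ neu L a = 3) ∨
    ((a + 2 = L ∨ a + 5 = L) ∧ neu L a = 2) ∨
    ((a + 1 = L ∨ a + 4 = L) ∧ neu L a = 1) ∨
    ((a + 6 < L ∨ L < a) ∧ neu L a = perc a) := by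
  by_cases ha : a = L
  · subst ha; exact Or.inl ⟨rfl, neu_last a⟩
  · obtain ⟨v, hv⟩ : ∃ v, v = neu L a := ⟨_, rfl⟩
    rw [← hv]
    unfold neu at hv
    rw [if_neg ha, if_neg (by omega), if_neg (by omega), if_neg (by omega),
      if_neg (by omega)] at hv
    split_ifs at hv <;> omega

theorem good_N1 {L : ℕ} (hL : L % 4 = 1) : Good (neu L) L 3 4 := by
  have sp := neu_spec1 hL
  refine ⟨?_, ?_, ?_, ?_, ?_⟩
  · have := sp 0; have := perc_spec 0; omega
  · have := sp L; omega
  · intro a; have := sp a; have := perc_spec a; omega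
  · intro a b hab hb h
    have h1 := perc_spec a
    have h2 := perc_spec b
    rcases sp a with s1 | s1 | s1 | s1 <;> rcases sp b with s2 | s2 | s2 | s2 <;> omega
  · intro a ha ha'
    have h1 := perc_spec a
    rcases sp a with s1 | s1 | s1 | s1 <;> omega

theorem good_N2 {L q : ℕ} (hL : L % 4 = 2 ∨ (L % 4 = 0 ∧ L ≤ 8)) (h0 : 1 ≤ L)
    (hq : q = 2 ∨ (q = 3 ∧ L % 4 = 2)) : Good (neu L) L q 4 := by
  have sp := neu_spec2 hL
  refine ⟨?_, ?_, ?_, ?_, ?_⟩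
  · have := sp 0; have := perc_spec 0; omega
  · have := sp L; omega
  · intro a; have := sp a; have := perc_spec a; omega
  · intro a b hab hb h
    have h1 := perc_spec a
    have h2 := perc_spec b
    rcases sp a with s1 | s1 <;> rcases sp b with s2 | s2 <;> omega
  · intro a ha ha'
    have h1 := perc_spec a
    rcases sp a with s1 | s1 <;> omega

theorem good_N3 {L : ℕ} (hL : L % 4 = 3) (h8 : 8 < L) : Good (neu L) L 3 4 := by
  have sp := neu_spec3 hL
  refine ⟨?_, ?_, ?_, ?_, ?_⟩
  · have := sp 0; have := perc_spec 0; omega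
  · have := sp L; omega
  · intro a; have := sp a; have := perc_spec a; omega
  · intro a b hab hb h
    have h1 := perc_spec a
    have h2 := perc_spec b
    rcases sp a with s1 | s1 | s1 | s1 | s1 | s1 <;>
      rcases sp b with s2 | s2 | s2 | s2 | s2 | s2 <;> omega
  · intro a ha ha'
    have h1 := perc_spec a
    rcases sp a with s1 | s1 | s1 | s1 | s1 | s1 <;> omega

theorem good_N0 {L : ℕ} (hL : L % 4 = 0) (h8 : 8 < L) : Good (neu L) L 3 4 := by
  have sp := neu_spec0 hL h8
  refine ⟨?_, ?_, ?_, ?_, ?_⟩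
  · have := sp 0; have := perc_spec 0; omega
  · have := sp L; omega
  · intro a; have := sp a; have := perc_spec a; omega
  · intro a b hab hb h
    have h1 := perc_spec a
    have h2 := perc_spec b
    rcases sp a with s1 | s1 | s1 | s1 | s1 | s1 <;>
      rcases sp b with s2 | s2 | s2 | s2 | s2 | s2 <;> omega
  · intro a ha ha'
    have h1 := perc_spec a
    rcases sp a with s1 | s1 | s1 | s1 | s1 | s1 <;> omega

theorem Good.mono {c : ℕ → ℕ} {L r : ℕ} (h : Good c L 3 r) : Good c L 2 r := by
  obtain ⟨h1, h2, h3, h4, h5⟩ := h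
  refine ⟨h1, h2, h3, h4, fun a ha ha' => ?_⟩
  obtain ⟨g1, g2, g3⟩ := h5 a ha ha'
  exact ⟨g1, fun h => ⟨(g2 h).1, by have := (g2 h).2; omega⟩, g3⟩

theorem good_N' {L : ℕ} (h0 : 1 ≤ L) (h3 : L ≠ 3) (h7 : L ≠ 7)
    (h4 : L ≠ 4) (h8 : L ≠ 8) : Good (neu L) L 3 4 := by
  have hL : L % 4 = 0 ∨ L % 4 = 1 ∨ L % 4 = 2 ∨ L % 4 = 3 := by omega
  rcases hL with hL | hL | hL | hL
  · exact good_N0 hL (by omega)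
  · exact good_N1 hL
  · exact good_N2 (Or.inl hL) h0 (Or.inr ⟨rfl, hL⟩)
  · exact good_N3 hL (by omega)

theorem good_N {L : ℕ} (h0 : 1 ≤ L) (h3 : L ≠ 3) (h7 : L ≠ 7) : Good (neu L) L 2 4 := by
  by_cases h : L = 4 ∨ L = 8
  · exact good_N2 (Or.inr (by omega)) h0 (Or.inl rfl)
  · exact (good_N' h0 h3 h7 (by omega) (by omega)).mono

section bwd2

variable {p : ℕ} {ℓ : Fin p → ℕ}

theorem pz {m : ℕ} (h : pathCount p ℓ m = 0) (i : Fin p) : ℓ i ≠ m := by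
  intro hi
  have := Finset.card_eq_zero.1 h
  have h2 : i ∈ (Finset.univ.filter (fun i : Fin p => ℓ i = m)) := by simp [hi]
  rw [this] at h2
  simp at h2

theorem pone {m : ℕ} (h : pathCount p ℓ m ≤ 1) {i j : Fin p} (hi : ℓ i = m) (hj : ℓ j = m) :
    i = j :=
  Finset.card_le_one.1 h i (by simp [hi]) j (by simp [hj])

/-- Mode A: at most one path of length 7, coloured with a 4 close to `u`. -/
theorem modeA {m : ℕ} (hm1 : 1 ≤ m) (hm : ∀ i, m ≤ ℓ i)
    (h3 : ∀ i, ℓ i ≠ 3) (h7 : ∀ i j, ℓ i = 7 → ℓ j = 7 → i = j)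
    (h7' : 3 ≤ m ∨ ∀ i, ℓ i ≠ 7) :
    ∃ c : Fin p → ℕ → ℕ, IsPackingColoring (thetaGraph p ℓ) 4 (glue c) := by
  refine ⟨fun i => if ℓ i = 7 then spF (ℓ i) else neu (ℓ i),
    glue_spec hm1 hm _ (fun i => if ℓ i = 7 then 3 else 2) (fun i => if ℓ i = 7 then 2 else 4)
    ?_ ?_ ?_ ?_ ?_ ?_⟩
  · intro i
    by_cases h : ℓ i = 7
    · simp only [if_pos h]; exact good_F (Or.inl h)
    · simp only [if_neg h]; exact good_N (hm1.trans (hm i)) (h3 i) h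
  · intro i; split_ifs <;> omega
  · intro i; split_ifs <;> omega
  · intro i j _; split_ifs <;> omega
  · intro i j hij; split_ifs with a b b
    · exact (hij (h7 i j a b)).elim
    all_goals omega
  · intro i; split_ifs with a
    · rcases h7' with h | h
      · omega
      · exact (h i a).elim
    · omega

/-- Mode B: a set `S` of at most one path of length 3 or 7, a set `F` of at most one path of
length 7 or 8. -/
theorem modeB {m : ℕ} (hm1 : 1 ≤ m) (hm : ∀ i, m ≤ ℓ i) (S F : Fin p → Prop)
    (hS : ∀ i, S i → ℓ i = 3 ∨ ℓ i = 7) (hF : ∀ i, F i → ℓ i = 7 ∨ ℓ i = 8)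
    (hS1 : ∀ i j, S i → S j → i = j) (hF1 : ∀ i j, F i → F j → i = j)
    (hN : ∀ i, ¬ S i → ¬ F i → ℓ i ≠ 3 ∧ ℓ i ≠ 7 ∧ ℓ i ≠ 4 ∧ ℓ i ≠ 8)
    (hmF : 3 ≤ m ∨ ∀ i, ¬ F i) :
    ∃ c : Fin p → ℕ → ℕ, IsPackingColoring (thetaGraph p ℓ) 4 (glue c) := by
  classical
  refine ⟨fun i => if S i then spS (ℓ i) else if F i then spF (ℓ i) else neu (ℓ i),
    glue_spec hm1 hm _ (fun i => if S i then 1 else 3)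
    (fun i => if S i then 4 else if F i then 2 else 4) ?_ ?_ ?_ ?_ ?_ ?_⟩
  · intro i
    by_cases h : S i
    · simp only [if_pos h]; exact good_S (hS i h)
    · by_cases h' : F i
      · simp only [if_neg h, if_pos h']; exact good_F (hF i h')
      · simp only [if_neg h, if_neg h']
        obtain ⟨a, b, c, d⟩ := hN i h h'
        exact good_N' (hm1.trans (hm i)) a b c d
  · intro i; split_ifs <;> omega
  · intro i; split_ifs <;> omega
  · intro i j hij; split_ifs with a b b
    · exact (hij (hS1 i j a b)).elim
    all_goals omega
  · intro i j hij
    have := fun a b => hij (hF1 i j a b)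
    split_ifs <;> first | omega | (exfalso; tauto)
  · intro i; split_ifs with a b
    · omega
    · rcases hmF with h | h
      · omega
      · exact (h i b).elim
    · omega

theorem min3 (hpos : ∀ i, 1 ≤ ℓ i) (h1 : pathCount p ℓ 1 = 0) (h2 : pathCount p ℓ 2 = 0)
    (i : Fin p) : 3 ≤ ℓ i := by
  have := pz h1 i
  have := pz h2 i
  have := hpos i
  omega

theorem backward (hpos : ∀ i, 1 ≤ ℓ i) (n : ℕ → ℕ) (hn : n = pathCount p ℓ)
    (h : (n 3 = 0 ∧ n 7 = 0) ∨ (n 3 = 0 ∧ n 4 = 0 ∧ n 7 ≤ 1 ∧ n 8 = 0) ∨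
    (n 3 ≤ 1 ∧ n 4 = 0 ∧ n 7 = 0 ∧ n 8 = 0) ∨
    (n 1 = 0 ∧ n 2 = 0 ∧ n 3 = 0 ∧ n 7 ≤ 1) ∨
    (n 1 = 0 ∧ n 2 = 0 ∧ n 3 = 0 ∧ n 4 = 0 ∧ n 7 = 2 ∧ n 8 = 0) ∨
    (n 1 = 0 ∧ n 2 = 0 ∧ n 3 ≤ 1 ∧ n 4 = 0 ∧ n 7 + n 8 ≤ 1)) :
    ∃ c : Fin p → ℕ → ℕ, IsPackingColoring (thetaGraph p ℓ) 4 (glue c) := by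
  subst hn
  rcases h with ⟨a3, a7⟩ | ⟨a3, a4, a7, a8⟩ | ⟨a3, a4, a7, a8⟩ | ⟨a1, a2, a3, a7⟩ |
    ⟨a1, a2, a3, a4, a7, a8⟩ | ⟨a1, a2, a3, a4, a78⟩
  · exact modeA le_rfl hpos (pz a3) (fun i j hi _ => (pz a7 i hi).elim) (Or.inr (pz a7))
  · refine modeB le_rfl hpos (fun i => ℓ i = 7) (fun _ => False) (fun i h => Or.inr h)
      (fun i h => h.elim) (fun i j => pone a7) (fun i j h => h.elim) ?_ (Or.inr fun i h => h)
    exact fun i h _ => ⟨pz a3 i, h, pz a4 i, pz a8 i⟩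
  · refine modeB le_rfl hpos (fun i => ℓ i = 3) (fun _ => False) (fun i h => Or.inl h)
      (fun i h => h.elim) (fun i j => pone a3) (fun i j h => h.elim) ?_ (Or.inr fun i h => h)
    exact fun i h _ => ⟨h, pz a7 i, pz a4 i, pz a8 i⟩
  · exact modeA (m := 3) (by norm_num) (min3 hpos a1 a2) (pz a3) (fun i j => pone a7)
      (Or.inl le_rfl)
  · obtain ⟨i, j, hij, hs⟩ := Finset.card_eq_two.1 a7
    have hmem : ∀ k, ℓ k = 7 ↔ k = i ∨ k = j := fun k => by
      have : k ∈ (Finset.univ.filter (fun i : Fin p => ℓ i = 7)) ↔ k ∈ ({i, j} : Finset _) := by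
        rw [hs]
      simpa using this
    refine modeB (m := 3) (by norm_num) (min3 hpos a1 a2) (fun k => k = i) (fun k => k = j)
      (fun k h => Or.inr ((hmem k).2 (Or.inl h))) (fun k h => Or.inl ((hmem k).2 (Or.inr h)))
      (fun a b ha hb => ha.trans hb.symm) (fun a b ha hb => ha.trans hb.symm) ?_ (Or.inl le_rfl)
    intro k h1 h2
    refine ⟨pz a3 k, fun h => ?_, pz a4 k, pz a8 k⟩
    rcases (hmem k).1 h with h | h
    · exact h1 h
    · exact h2 h
  · refine modeB (m := 3) (by norm_num) (min3 hpos a1 a2) (fun k => ℓ k = 3)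
      (fun k => ℓ k = 7 ∨ ℓ k = 8) (fun i h => Or.inl h) (fun i h => h)
      (fun i j => pone a3) ?_ ?_ (Or.inl le_rfl)
    · intro i j hi hj
      have h7 : pathCount p ℓ 7 ≤ 1 := by omega
      have h8 : pathCount p ℓ 8 ≤ 1 := by omega
      by_cases hz : pathCount p ℓ 7 = 0
      · exact pone h8 (hi.resolve_left (pz hz i)) (hj.resolve_left (pz hz j))
      · have hz' : pathCount p ℓ 8 = 0 := by omega
        exact pone h7 (hi.resolve_right (pz hz' i)) (hj.resolve_right (pz hz' j))
    · intro i h1 h2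
      exact ⟨h1, fun h => h2 (Or.inl h), pz a4 i, fun h => h2 (Or.inr h)⟩

end bwd2

theorem count_one {p : ℕ} {ℓ : Fin p → ℕ} (hp : 1 < p)
    (hmono : Monotone ℓ) (hsimple : 2 ≤ ℓ ⟨1, hp⟩) : pathCount p ℓ 1 ≤ 1 := by
  by_contra h
  obtain ⟨i, j, hij, hi, hj⟩ := pc2 (ℓ := ℓ) (m := 1) (by omega)
  have key : ∀ k : Fin p, ℓ k = 1 → (k : ℕ) = 0 := by
    intro k hk
    by_contra h0
    have h1 : (⟨1, hp⟩ : Fin p) ≤ k := by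
      rw [Fin.le_def]; simp only; omega
    have := hmono h1
    omega
  exact hij (Fin.ext ((key i hi).trans (key j hj).symm))

theorem stmt8 (p : ℕ) (ℓ : Fin p → ℕ) (hp : 3 ≤ p)
    (hmono : Monotone ℓ) (hpos : ∀ i, 1 ≤ ℓ i) (hsimple : 2 ≤ ℓ ⟨1, by omega⟩) :
    (∃ π : ThetaVert p ℓ → ℕ, IsPackingColoring (thetaGraph p ℓ) 4 π ∧ π (thetaU p ℓ) = 2 ∧ π (thetaV p ℓ) = 4) ↔
      ((pathCount p ℓ 1 ≤ 1 ∧ pathCount p ℓ 3 = 0 ∧ pathCount p ℓ 7 = 0) ∨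
       (pathCount p ℓ 1 ≤ 1 ∧ pathCount p ℓ 3 = 0 ∧ pathCount p ℓ 4 = 0 ∧ pathCount p ℓ 7 ≤ 1 ∧ pathCount p ℓ 8 = 0) ∨
       (pathCount p ℓ 1 ≤ 1 ∧ pathCount p ℓ 3 ≤ 1 ∧ pathCount p ℓ 4 = 0 ∧ pathCount p ℓ 7 = 0 ∧ pathCount p ℓ 8 = 0) ∨
       (pathCount p ℓ 1 = 0 ∧ pathCount p ℓ 2 = 0 ∧ pathCount p ℓ 3 = 0 ∧ pathCount p ℓ 7 ≤ 1) ∨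
       (pathCount p ℓ 1 = 0 ∧ pathCount p ℓ 2 = 0 ∧ pathCount p ℓ 3 = 0 ∧ pathCount p ℓ 4 = 0 ∧ pathCount p ℓ 7 = 2 ∧ pathCount p ℓ 8 = 0) ∨
       (pathCount p ℓ 1 = 0 ∧ pathCount p ℓ 2 = 0 ∧ pathCount p ℓ 3 ≤ 1 ∧ pathCount p ℓ 4 = 0 ∧ pathCount p ℓ 7 + pathCount p ℓ 8 ≤ 1) ∨
       (pathCount p ℓ 1 = 0 ∧ pathCount p ℓ 3 = 0 ∧ pathCount p ℓ 7 = 0) ∨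
       (pathCount p ℓ 1 = 0 ∧ pathCount p ℓ 3 = 0 ∧ pathCount p ℓ 4 = 0 ∧ pathCount p ℓ 7 ≤ 1 ∧ pathCount p ℓ 8 = 0) ∨
       (pathCount p ℓ 1 = 0 ∧ pathCount p ℓ 3 ≤ 1 ∧ pathCount p ℓ 4 = 0 ∧ pathCount p ℓ 7 = 0 ∧ pathCount p ℓ 8 = 0)) := by
  have h1 := count_one (lt_of_lt_of_le (by norm_num) hp) hmono hsimple
  constructor
  · rintro ⟨π, hπ, hu, hv⟩
    rcases forward hpos hπ hu hv _ rfl with h | h | h | h | h | h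
    · exact Or.inl ⟨h1, h⟩
    · exact Or.inr (Or.inl ⟨h1, h⟩)
    · exact Or.inr (Or.inr (Or.inl ⟨h1, h⟩))
    · exact Or.inr (Or.inr (Or.inr (Or.inl h)))
    · exact Or.inr (Or.inr (Or.inr (Or.inr (Or.inl h))))
    · exact Or.inr (Or.inr (Or.inr (Or.inr (Or.inr (Or.inl h)))))
  · intro h
    obtain ⟨c, hc⟩ := backward hpos (pathCount p ℓ) rfl (by
      rcases h with ⟨-, h⟩ | ⟨-, h⟩ | ⟨-, h⟩ | h | h | h | ⟨-, h⟩ | ⟨-, h⟩ | ⟨-, h⟩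
      · exact Or.inl h
      · exact Or.inr (Or.inl h)
      · exact Or.inr (Or.inr (Or.inl h))
      · exact Or.inr (Or.inr (Or.inr (Or.inl h)))
      · exact Or.inr (Or.inr (Or.inr (Or.inr (Or.inl h))))
      · exact Or.inr (Or.inr (Or.inr (Or.inr (Or.inr h))))
      · exact Or.inl h
      · exact Or.inr (Or.inl h)
      · exact Or.inr (Or.inr (Or.inl h)))
    exact ⟨glue c, hc, rfl, rfl⟩
end

section
/- Let Θ = Θ_{ℓ1,…,ℓp} be a generalized theta graph with p ≥ 3. There exists a packing 4-coloring π of Θ with π(u) = 2 and π(v) = 3 if and only if one of the following conditions holds: (i) n_1 ≤ 1 and the total number of paths of length at least 3 (i.e., Σ_{i≥3} n_i) is at most 1; or (ii) n_1 = 0 and n_3 + n_4 + n_5 ≤ 1. -/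
namespace ThetaAux

variable {p : ℕ} {ℓ : Fin p → ℕ}

/-- A function that is 1-Lipschitz along edges bounds the extended distance from below. -/
lemma lip_edist {V : Type*} (G : SimpleGraph V) (f : V → ℕ)
    (hf : ∀ a b, G.Adj a b → f b ≤ f a + 1) (x y : V) (hx : f x = 0) (c : ℕ) (hc : c < f y) :
    (c : ℕ∞) < G.edist x y := by
  have key : ∀ {a b : V} (w : G.Walk a b), f b ≤ f a + w.length := by
    intro a b w
    induction w with
    | nil => simp
    | cons h w ih =>
      have := hf _ _ h
      simp only [SimpleGraph.Walk.length_cons]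
      omega
  by_contra hcon
  push Not at hcon
  have hne : G.edist x y ≠ ⊤ := by
    intro h
    rw [h] at hcon
    exact absurd hcon (by simp)
  obtain ⟨w, hw⟩ := (SimpleGraph.edist_ne_top_iff_reachable.mp hne).exists_walk_length_eq_edist
  rw [← hw] at hcon
  have h1 : w.length ≤ c := by exact_mod_cast hcon
  have := key w
  omega

/-- Checking a property symmetric in edges on the base relation only. -/
lemma theta_lip (f : ThetaVert p ℓ → ℕ)
    (huv : (∃ i, ℓ i = 1) → f (Sum.inl true) ≤ f (Sum.inl false) + 1 ∧
      f (Sum.inl false) ≤ f (Sum.inl true) + 1)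
    (hu : ∀ i (j : Fin (ℓ i - 1)), (j : ℕ) = 0 → f (Sum.inl false) ≤ f (Sum.inr ⟨i, j⟩) + 1 ∧
      f (Sum.inr ⟨i, j⟩) ≤ f (Sum.inl false) + 1)
    (hv : ∀ i (j : Fin (ℓ i - 1)), (j : ℕ) + 2 = ℓ i →
      f (Sum.inl true) ≤ f (Sum.inr ⟨i, j⟩) + 1 ∧
      f (Sum.inr ⟨i, j⟩) ≤ f (Sum.inl true) + 1)
    (hin : ∀ i (j k : Fin (ℓ i - 1)), (j : ℕ) + 1 = k →
      f (Sum.inr ⟨i, j⟩) ≤ f (Sum.inr ⟨i, k⟩) + 1 ∧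
      f (Sum.inr ⟨i, k⟩) ≤ f (Sum.inr ⟨i, j⟩) + 1) :
    ∀ a b, (thetaGraph p ℓ).Adj a b → f b ≤ f a + 1 := by
  have main : ∀ a b, thetaRel p ℓ a b → f b ≤ f a + 1 ∧ f a ≤ f b + 1 := by
    intro a b h
    match a, b, h with
    | Sum.inl a, Sum.inl b, h =>
      obtain ⟨rfl, rfl, h⟩ := h
      exact huv h
    | Sum.inl a, Sum.inr ⟨i, j⟩, h =>
      rcases h with ⟨rfl, h⟩ | ⟨rfl, h⟩
      · exact (hu i j h).symm
      · exact (hv i j h).symm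
    | Sum.inr ⟨i, j⟩, Sum.inr ⟨i', j'⟩, h =>
      obtain ⟨h1, h2⟩ := h
      have : i = i' := Fin.ext h1
      subst this
      exact (hin i j j' h2).symm
    | Sum.inr _, Sum.inl _, h => exact h.elim
  intro a b hab
  rw [thetaGraph, SimpleGraph.fromRel_adj] at hab
  rcases hab.2 with h | h
  · exact (main _ _ h).1
  · exact (main _ _ h).2

/-- Lower bound for the distance from `u`. -/
def fU (D : ℕ) : ThetaVert p ℓ → ℕ
  | Sum.inl false => 0
  | Sum.inl true => D
  | Sum.inr ⟨i, k⟩ => min ((k : ℕ) + 1) (D + (ℓ i - 1 - k))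

/-- Lower bound for the distance from `v`. -/
def fV (D : ℕ) : ThetaVert p ℓ → ℕ
  | Sum.inl false => D
  | Sum.inl true => 0
  | Sum.inr ⟨i, k⟩ => min (D + ((k : ℕ) + 1)) (ℓ i - 1 - k)

/-- Lower bound for the distance from the internal vertex number `j` of path `i`. -/
def fX (D : ℕ) (i : Fin p) (j : ℕ) : ThetaVert p ℓ → ℕ
  | Sum.inl false => min j (ℓ i - j + D)
  | Sum.inl true => min (ℓ i - j) (j + D)
  | Sum.inr ⟨i', k⟩ =>
      if i' = i then
        min (max (j - ((k : ℕ) + 1)) (((k : ℕ) + 1) - j))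
          (min (j + D + (ℓ i - ((k : ℕ) + 1))) (((k : ℕ) + 1) + D + (ℓ i - j)))
      else min (min j (ℓ i - j + D) + ((k : ℕ) + 1)) (min (ℓ i - j) (j + D) + (ℓ i' - ((k : ℕ) + 1)))

lemma lipU (D : ℕ) (hD : ∀ i, D ≤ ℓ i) (a b) (h : (thetaGraph p ℓ).Adj a b) :
    fU D b ≤ fU D a + 1 := by
  refine theta_lip (fU D) ?_ ?_ ?_ ?_ a b h
  · rintro ⟨i, hi⟩
    have := hD i
    simp only [fU]; omega
  · intro i j hj
    have := hD i
    simp only [fU]; omega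
  · intro i j hj
    have := hD i
    simp only [fU]; omega
  · intro i j k hj
    have := hD i
    simp only [fU]; omega

lemma lipV (D : ℕ) (hD : ∀ i, D ≤ ℓ i) (a b) (h : (thetaGraph p ℓ).Adj a b) :
    fV D b ≤ fV D a + 1 := by
  refine theta_lip (fV D) ?_ ?_ ?_ ?_ a b h
  · rintro ⟨i, hi⟩
    have := hD i
    simp only [fV]; omega
  · intro i j hj
    have := hD i
    simp only [fV]; omega
  · intro i j hj
    have := hD i
    simp only [fV]; omega
  · intro i j k hj
    have := hD i
    simp only [fV]; omega

lemma lipX (D : ℕ) (hD : ∀ i, D ≤ ℓ i) (i₀ : Fin p) (j₀ : ℕ) (h0 : 1 ≤ j₀) (h1 : j₀ < ℓ i₀)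
    (a b) (h : (thetaGraph p ℓ).Adj a b) :
    fX D i₀ j₀ b ≤ fX D i₀ j₀ a + 1 := by
  have h2 := hD i₀
  refine theta_lip (fX D i₀ j₀) ?_ ?_ ?_ ?_ a b h
  · rintro ⟨i, hi⟩
    have := hD i
    simp only [fX]; omega
  · intro i j hj
    have := hD i
    have := j.2
    by_cases hi : i = i₀
    · subst hi
      simp only [fX, if_true]; omega
    · simp only [fX, if_neg hi]; omega
  · intro i j hj
    have := hD i
    have := j.2
    by_cases hi : i = i₀
    · subst hi
      simp only [fX, if_true]; omega
    · simp only [fX, if_neg hi]; omega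
  · intro i j k hj
    have := hD i
    have := k.2
    by_cases hi : i = i₀
    · subst hi
      simp only [fX, if_true]; omega
    · simp only [fX, if_neg hi]; omega

/-- Coloring of the theta graph where the color on a path depends on its length only. -/
def mkCol (c : ℕ → ℕ → ℕ) : ThetaVert p ℓ → ℕ
  | Sum.inl false => 2
  | Sum.inl true => 3
  | Sum.inr ⟨i, k⟩ => c (ℓ i) ((k : ℕ) + 1)

lemma mkCol_packing (c : ℕ → ℕ → ℕ) (D : ℕ) (hD : ∀ i, D ≤ ℓ i)
    (hr : ∀ i j, 1 ≤ j → j < ℓ i → 1 ≤ c (ℓ i) j ∧ c (ℓ i) j ≤ 4)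
    (h2 : ∀ i j, 1 ≤ j → j < ℓ i → c (ℓ i) j = 2 → 2 < j ∧ 2 < D + (ℓ i - j))
    (h3 : ∀ i j, 1 ≤ j → j < ℓ i → c (ℓ i) j = 3 → 3 < D + j ∧ 3 < ℓ i - j)
    (hs : ∀ i j k, 1 ≤ j → j < k → k < ℓ i → c (ℓ i) j = c (ℓ i) k →
      c (ℓ i) j < k - j ∧ c (ℓ i) j < j + D + (ℓ i - k))
    (hd : ∀ i i' j k, i ≠ i' → 1 ≤ j → j < ℓ i → 1 ≤ k → k < ℓ i' → c (ℓ i) j = c (ℓ i') k →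
      c (ℓ i) j < j + k ∧ c (ℓ i) j < (ℓ i - j) + (ℓ i' - k) ∧ c (ℓ i) j < j + D + (ℓ i' - k) ∧
      c (ℓ i) j < k + D + (ℓ i - j)) :
    IsPackingColoring (thetaGraph p ℓ) 4 (mkCol c) := by
  have hUX : ∀ i (k : Fin (ℓ i - 1)), 2 = c (ℓ i) ((k : ℕ) + 1) →
      ((2 : ℕ) : ℕ∞) < (thetaGraph p ℓ).edist (Sum.inl false) (Sum.inr ⟨i, k⟩) := by
    intro i k h
    have hk := k.2
    refine lip_edist _ (fU D) (lipU D hD) _ _ rfl _ ?_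
    have := h2 i (k + 1) (by omega) (by omega) h.symm
    simp only [fU]; omega
  have hVX : ∀ i (k : Fin (ℓ i - 1)), 3 = c (ℓ i) ((k : ℕ) + 1) →
      ((3 : ℕ) : ℕ∞) < (thetaGraph p ℓ).edist (Sum.inl true) (Sum.inr ⟨i, k⟩) := by
    intro i k h
    have hk := k.2
    refine lip_edist _ (fV D) (lipV D hD) _ _ rfl _ ?_
    have := h3 i (k + 1) (by omega) (by omega) h.symm
    simp only [fV]; omega
  constructor
  · intro x
    match x with
    | Sum.inl false => simp [mkCol]
    | Sum.inl true => simp [mkCol]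
    | Sum.inr ⟨i, k⟩ =>
      have := k.2
      exact hr i (k + 1) (by omega) (by omega)
  · intro x y hxy hc
    match x, y, hxy, hc with
    | Sum.inl false, Sum.inl false, hxy, _ => exact absurd rfl hxy
    | Sum.inl true, Sum.inl true, hxy, _ => exact absurd rfl hxy
    | Sum.inl true, Sum.inl false, _, hc => exact absurd hc (by simp [mkCol])
    | Sum.inl false, Sum.inl true, _, hc => exact absurd hc (by simp [mkCol])
    | Sum.inl false, Sum.inr ⟨i, k⟩, _, hc => exact hUX i k hc
    | Sum.inl true, Sum.inr ⟨i, k⟩, _, hc => exact hVX i k hc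
    | Sum.inr ⟨i, k⟩, Sum.inl false, _, hc =>
      rw [hc]; exact (hUX i k hc.symm).trans_eq SimpleGraph.edist_comm
    | Sum.inr ⟨i, k⟩, Sum.inl true, _, hc =>
      rw [hc]; exact (hVX i k hc.symm).trans_eq SimpleGraph.edist_comm
    | Sum.inr ⟨i, j⟩, Sum.inr ⟨i', k⟩, hxy, hc =>
      have hj := j.2
      have hk := k.2
      have hc' : c (ℓ i) ((j : ℕ) + 1) = c (ℓ i') ((k : ℕ) + 1) := hc
      refine lip_edist _ (fX D i (j + 1)) (lipX D hD i _ (by omega) (by omega)) _ _ ?_ _ ?_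
      · simp [fX]
      · by_cases hi : i' = i
        · subst hi
          simp only [fX, mkCol, if_true]
          rcases lt_trichotomy (j : ℕ) (k : ℕ) with h | h | h
          · have := hs i' (j + 1) (k + 1) (by omega) (by omega) (by omega) hc'
            omega
          · exact absurd (by rw [Fin.ext h]) hxy
          · have := hs i' (k + 1) (j + 1) (by omega) (by omega) (by omega) hc'.symm
            omega
        · have := hd i i' (j + 1) (k + 1) (Ne.symm hi) (by omega) (by omega) (by omega)
            (by omega) hc'
          simp only [fX, mkCol, if_neg hi]
          omega

/-- Colors read backwards from `v`. -/
def back (m : ℕ) : ℕ := if m % 4 = 0 then 3 else if m % 4 = 2 then 2 else 1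

/-- Coloring of the paths in case (i). -/
def cI (L j : ℕ) : ℕ := if j = 1 then 1 else if j = 2 then 4 else back (L - j)

/-- Coloring of the paths in case (ii). -/
def cII (L j : ℕ) : ℕ :=
  if L = 2 then 1
  else if L = 3 then (if j = 1 then 4 else 1)
  else if L ≤ 5 then (if j = 2 then 4 else if L = 5 ∧ j = 3 then 2 else 1)
  else if j = 1 then 1
  else if j = 2 then 3
  else if j = 3 then 1
  else if j = 4 then (if L % 4 = 0 ∨ L % 4 = 3 then 4 else 2)
  else if j = 5 ∧ L % 4 = 1 then 4
  else back (L - j)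

lemma caseI (hpos : ∀ i, 1 ≤ ℓ i)
    (hl : ∀ i i', i ≠ i' → ¬ (3 ≤ ℓ i ∧ 3 ≤ ℓ i')) :
    IsPackingColoring (thetaGraph p ℓ) 4 (mkCol cI) := by
  apply mkCol_packing cI 1 hpos
  · intro i j h1 h2
    unfold cI back; split_ifs <;> omega
  · intro i j h1 h2 h
    unfold cI back at h; split_ifs at h <;> omega
  · intro i j h1 h2 h
    unfold cI back at h; split_ifs at h <;> omega
  · intro i j k h1 h2 h3 h
    generalize ℓ i = L at *
    unfold cI back at *; split_ifs at * <;> omega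
  · intro i i' j k hne h1 h2 h3 h4 h
    have := hl i i' hne
    clear hne
    generalize ℓ i = L at *
    generalize ℓ i' = L' at *
    unfold cI back at *; split_ifs at * <;> omega

/-- Positions of each color in case (ii). -/
lemma cII_spec (L j : ℕ) (h1 : 1 ≤ j) (h2 : j < L) :
    (cII L j = 1) ∨
    (cII L j = 2 ∧ 3 ≤ j ∧ j + 2 ≤ L) ∨
    (cII L j = 3 ∧ 2 ≤ j ∧ j + 4 ≤ L) ∨
    (cII L j = 4 ∧ ((3 ≤ L ∧ L ≤ 5 ∧ j + 2 ≤ L) ∨ (6 ≤ L ∧ 4 ≤ j ∧ j + 3 ≤ L))) := by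
  unfold cII back; split_ifs <;> omega

/-- More precise positions of each color in case (ii) for the long paths. -/
lemma cII_spec' (L j : ℕ) (h1 : 1 ≤ j) (h2 : j < L) (h6 : 6 ≤ L) :
    (cII L j = 1 ∧ (j = 1 ∨ j = 3 ∨ (5 ≤ j ∧ (L - j) % 2 = 1))) ∨
    (cII L j = 2 ∧ ((j = 4 ∧ (L % 4 = 1 ∨ L % 4 = 2)) ∨ (5 ≤ j ∧ (L - j) % 4 = 2))) ∨
    (cII L j = 3 ∧ (j = 2 ∨ (6 ≤ j ∧ (L - j) % 4 = 0))) ∨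
    (cII L j = 4 ∧ ((j = 4 ∧ (L % 4 = 0 ∨ L % 4 = 3)) ∨ (j = 5 ∧ L % 4 = 1))) := by
  rw [cII, if_neg (by omega), if_neg (by omega), if_neg (by omega)]
  unfold back
  split_ifs
  all_goals first
    | exact Or.inl ⟨rfl, by omega⟩
    | exact Or.inr (Or.inl ⟨rfl, by omega⟩)
    | exact Or.inr (Or.inr (Or.inl ⟨rfl, by omega⟩))
    | exact Or.inr (Or.inr (Or.inr ⟨rfl, by omega⟩))

lemma cII_same (L j k : ℕ) (h1 : 1 ≤ j) (h2 : j < k) (h3 : k < L) (h : cII L j = cII L k) :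
    cII L j < k - j ∧ cII L j < j + 2 + (L - k) := by
  by_cases h6 : 6 ≤ L
  · have a := cII_spec' L j h1 (by omega) h6
    have b := cII_spec' L k (by omega) h3 h6
    generalize cII L j = x at *
    generalize cII L k = y at *
    subst h
    rcases a with a | a | a | a <;> rcases b with b | b | b | b <;> omega
  · interval_cases L <;> interval_cases k <;> interval_cases j <;> revert h <;> decide

lemma caseII (hpos : ∀ i, 2 ≤ ℓ i)
    (hl : ∀ i i', i ≠ i' → ¬ (3 ≤ ℓ i ∧ ℓ i ≤ 5 ∧ 3 ≤ ℓ i' ∧ ℓ i' ≤ 5)) :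
    IsPackingColoring (thetaGraph p ℓ) 4 (mkCol cII) := by
  apply mkCol_packing cII 2 hpos
  · intro i j h1 h2
    have := cII_spec _ _ h1 h2
    omega
  · intro i j h1 h2 h
    have := cII_spec _ _ h1 h2
    omega
  · intro i j h1 h2 h
    have := cII_spec _ _ h1 h2
    omega
  · intro i j k h1 h2 h3 h
    exact cII_same _ j k h1 h2 h3 h
  · intro i i' j k hne h1 h2 h3 h4 h
    have := hl i i' hne
    have := cII_spec _ _ h1 h2
    have := cII_spec _ _ h3 h4
    generalize cII (ℓ i) j = a at *
    generalize cII (ℓ i') k = b at *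
    generalize ℓ i = L at *
    generalize ℓ i' = L' at *
    omega

/-- The `j`-th vertex of the `i`-th path, `u` for `j = 0` and `v` for `j ≥ ℓ i`. -/
def vtx (i : Fin p) (j : ℕ) : ThetaVert p ℓ :=
  if h : 1 ≤ j ∧ j < ℓ i then Sum.inr ⟨i, ⟨j - 1, by omega⟩⟩
  else if j = 0 then Sum.inl false
  else Sum.inl true

lemma vtx_mid (i : Fin p) (j : ℕ) (h : 1 ≤ j) (h' : j < ℓ i) :
    (vtx i j : ThetaVert p ℓ) = Sum.inr ⟨i, ⟨j - 1, by omega⟩⟩ := by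
  exact dif_pos ⟨h, h'⟩

lemma vtx_zero (i : Fin p) : (vtx i 0 : ThetaVert p ℓ) = thetaU p ℓ := by
  exact (dif_neg (by omega)).trans (if_pos rfl)

lemma vtx_last (i : Fin p) (h : 1 ≤ ℓ i) : (vtx i (ℓ i) : ThetaVert p ℓ) = thetaV p ℓ := by
  exact (dif_neg (by omega)).trans (if_neg (by omega))

lemma vtx_ne_U (i : Fin p) (j : ℕ) (h : 1 ≤ j) (h' : j < ℓ i) :
    (vtx i j : ThetaVert p ℓ) ≠ thetaU p ℓ := by
  rw [vtx_mid i j h h']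
  intro hh
  cases hh

lemma vtx_ne_V (i : Fin p) (j : ℕ) (h : 1 ≤ j) (h' : j < ℓ i) :
    (vtx i j : ThetaVert p ℓ) ≠ thetaV p ℓ := by
  rw [vtx_mid i j h h']
  intro hh
  cases hh

lemma vtx_ne (i k : Fin p) (j m : ℕ) (h : 1 ≤ j) (h' : j < ℓ i) (hm : 1 ≤ m) (hm' : m < ℓ k)
    (hik : i ≠ k ∨ j ≠ m) :
    (vtx i j : ThetaVert p ℓ) ≠ vtx k m := by
  rw [vtx_mid i j h h', vtx_mid k m hm hm']
  intro hh
  have h2 := Sum.inr.inj hh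
  have h3 : i = k := congrArg Sigma.fst h2
  subst h3
  simp at h2
  have h4 : j ≠ m := by simpa using hik
  omega

lemma vtx_adj (i : Fin p) (j : ℕ) (h : j < ℓ i) :
    (thetaGraph p ℓ).Adj (vtx i j) (vtx i (j + 1)) := by
  rw [thetaGraph, SimpleGraph.fromRel_adj]
  by_cases h0 : j = 0
  · subst h0
    by_cases h1 : 1 < ℓ i
    · refine ⟨?_, ?_⟩
      · rw [vtx_zero]; exact (vtx_ne_U i 1 le_rfl h1).symm
      · rw [vtx_zero, vtx_mid i (0 + 1) (by omega) h1]
        exact Or.inl (Or.inl ⟨rfl, rfl⟩)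
    · have h2 : 0 + 1 = ℓ i := by omega
      rw [vtx_zero, h2, vtx_last i h]
      refine ⟨?_, Or.inl ?_⟩
      · intro hh
        cases hh
      · exact ⟨rfl, rfl, i, h2.symm⟩
  · by_cases h1 : j + 1 < ℓ i
    · refine ⟨vtx_ne i i j (j + 1) (by omega) h (by omega) h1 (by omega), Or.inl ?_⟩
      rw [vtx_mid i j (by omega) h, vtx_mid i (j + 1) (by omega) h1]
      refine ⟨rfl, ?_⟩
      show j - 1 + 1 = j + 1 - 1
      omega
    · have h2 : j + 1 = ℓ i := by omega
      rw [h2, vtx_last i (by omega)]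
      refine ⟨vtx_ne_V i j (by omega) h, Or.inr ?_⟩
      rw [vtx_mid i j (by omega) h]
      refine Or.inr ⟨rfl, ?_⟩
      show j - 1 + 2 = ℓ i
      omega

lemma vtx_edist (i : Fin p) (j m : ℕ) (h : j + m ≤ ℓ i) :
    (thetaGraph p ℓ).edist (vtx i j) (vtx i (j + m)) ≤ m := by
  induction m with
  | zero => simp
  | succ m ih =>
    refine (SimpleGraph.edist_triangle (v := vtx i (j + m))).trans ?_
    have h1 : (thetaGraph p ℓ).edist (vtx i (j + m)) (vtx i (j + (m + 1))) = 1 :=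
      SimpleGraph.edist_eq_one_iff_adj.mpr (vtx_adj i (j + m) (by omega))
    rw [h1]
    push_cast
    gcongr
    exact ih (by omega)

lemma edist_U (i : Fin p) (j : ℕ) (h : j ≤ ℓ i) :
    (thetaGraph p ℓ).edist (thetaU p ℓ) (vtx i j) ≤ j := by
  have := vtx_edist (ℓ := ℓ) i 0 j (by omega)
  rwa [zero_add, vtx_zero] at this

lemma edist_V (i : Fin p) (j : ℕ) (h : j ≤ ℓ i) (h1 : 1 ≤ ℓ i) :
    (thetaGraph p ℓ).edist (vtx i j) (thetaV p ℓ) ≤ ((ℓ i - j : ℕ) : ℕ∞) := by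
  have := vtx_edist (ℓ := ℓ) i j (ℓ i - j) (by omega)
  rwa [show j + (ℓ i - j) = ℓ i by omega, vtx_last i h1] at this

lemma edist_UU (i k : Fin p) (j m : ℕ) (h : j ≤ ℓ i) (h' : m ≤ ℓ k) :
    (thetaGraph p ℓ).edist (vtx i j) (vtx k m) ≤ ((j + m : ℕ) : ℕ∞) := by
  refine (SimpleGraph.edist_triangle (v := thetaU p ℓ)).trans ?_
  push_cast
  gcongr
  · rw [SimpleGraph.edist_comm]; exact edist_U i j h
  · exact edist_U k m h'

lemma edist_UV (i k : Fin p) (j : ℕ) (h : j ≤ ℓ i) (h' : 1 ≤ ℓ k) :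
    (thetaGraph p ℓ).edist (vtx i j) (thetaV p ℓ) ≤ ((j + ℓ k : ℕ) : ℕ∞) := by
  have := edist_UU i k j (ℓ k) h le_rfl
  rwa [vtx_last k h'] at this

/-- A color cannot be repeated within its own range. -/
lemma no_rep {V : Type*} {G : SimpleGraph V} {n : ℕ} {π : V → ℕ} (h : IsPackingColoring G n π)
    (x y : V) (hxy : x ≠ y) (d : ℕ) (hd : G.edist x y ≤ d) (hc : d ≤ π x) : π x ≠ π y := by
  intro he
  have h1 := (h.2 x y hxy he).trans_le hd
  have h2 : π x < d := by exact_mod_cast h1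
  omega

/-- One of the two first internal vertices of a long path has color 3 or 4. -/
lemma big {π : ThetaVert p ℓ → ℕ} (hπ : IsPackingColoring (thetaGraph p ℓ) 4 π)
    (hU : π (thetaU p ℓ) = 2)
    (i : Fin p) (hi : 3 ≤ ℓ i) :
    ∃ j, 1 ≤ j ∧ j ≤ 2 ∧ (π (vtx i j) = 3 ∨ π (vtx i j) = 4) := by
  have a1 := hπ.1 (vtx i 1)
  have a2 := hπ.1 (vtx i 2)
  have b1 := no_rep hπ (thetaU p ℓ) (vtx i 1) (vtx_ne_U i 1 le_rfl (by omega)).symm 1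
    (edist_U i 1 (by omega)) (by omega)
  have b2 := no_rep hπ (thetaU p ℓ) (vtx i 2) (vtx_ne_U i 2 (by omega) (by omega)).symm 2
    (edist_U i 2 (by omega)) (by omega)
  have b3 := no_rep hπ (vtx i 1) (vtx i 2)
    (vtx_ne i i 1 2 (by omega) (by omega) (by omega) (by omega) (by omega)) 1
    (vtx_edist i 1 1 (by omega)) (by omega)
  rw [hU] at b1 b2
  by_cases h : π (vtx i 1) = 1
  · exact ⟨2, by omega, by omega, by omega⟩
  · exact ⟨1, by omega, by omega, by omega⟩

/-- Color 4 occurs on at most one path near `u`. -/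
lemma four {π : ThetaVert p ℓ → ℕ} (hπ : IsPackingColoring (thetaGraph p ℓ) 4 π)
    (i k : Fin p) (hik : i ≠ k) (j m : ℕ) (hi : 3 ≤ ℓ i) (hk : 3 ≤ ℓ k) (h1 : 1 ≤ j)
    (h2 : j ≤ 2) (h3 : 1 ≤ m) (h4 : m ≤ 2) : ¬ (π (vtx i j) = 4 ∧ π (vtx k m) = 4) :=
  fun ⟨hc, hc'⟩ => no_rep hπ (vtx i j) (vtx k m) (vtx_ne i k j m h1 (by omega) h3 (by omega) (Or.inl hik)) (j + m)
    (edist_UU i k j m (by omega) (by omega)) (by omega) (by omega)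

lemma three {π : ThetaVert p ℓ → ℕ} (hπ : IsPackingColoring (thetaGraph p ℓ) 4 π)
    (i k : Fin p) (hik : i ≠ k) (j m : ℕ) (hi : 3 ≤ ℓ i) (hk : 3 ≤ ℓ k) (h1 : 1 ≤ j)
    (h2 : j ≤ 2) (h3 : 1 ≤ m) (h4 : m ≤ 2) : ¬ (j + m ≤ 3 ∧ π (vtx i j) = 3 ∧ π (vtx k m) = 3) :=
  fun ⟨h5, hc, hc'⟩ => no_rep hπ (vtx i j) (vtx k m) (vtx_ne i k j m h1 (by omega) h3 (by omega) (Or.inl hik)) (j + m)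
    (edist_UU i k j m (by omega) (by omega)) (by omega) (by omega)

lemma threeV {π : ThetaVert p ℓ → ℕ} (hπ : IsPackingColoring (thetaGraph p ℓ) 4 π)
    (hV : π (thetaV p ℓ) = 3)
    (i : Fin p) (j : ℕ) (hi : 3 ≤ ℓ i) (h1 : 1 ≤ j) (h2 : j ≤ 2)
    (hc : π (vtx i j) = 3) : j + 4 ≤ ℓ i := by
  by_contra h
  exact no_rep hπ (vtx i j) (thetaV p ℓ) (vtx_ne_V i j h1 (by omega)) (ℓ i - j)
    (edist_V i j (by omega) (by omega)) (by omega) (by omega)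

lemma threeUV {π : ThetaVert p ℓ → ℕ} (hπ : IsPackingColoring (thetaGraph p ℓ) 4 π)
    (hV : π (thetaV p ℓ) = 3)
    (i k : Fin p) (j : ℕ) (hi : 3 ≤ ℓ i) (hk : 1 ≤ ℓ k) (h1 : 1 ≤ j) (h2 : j ≤ 2)
    (hc : π (vtx i j) = 3) : 4 ≤ j + ℓ k := by
  by_contra h
  exact no_rep hπ (vtx i j) (thetaV p ℓ) (vtx_ne_V i j h1 (by omega)) (j + ℓ k)
    (edist_UV i k j (by omega) (by omega)) (by omega) (by omega)

lemma nec1 {π : ThetaVert p ℓ → ℕ} (hπ : IsPackingColoring (thetaGraph p ℓ) 4 π)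
    (hU : π (thetaU p ℓ) = 2) (hV : π (thetaV p ℓ) = 3)
    (i k o : Fin p) (hik : i ≠ k) (hi : 3 ≤ ℓ i) (hk : 3 ≤ ℓ k) (ho : ℓ o = 1) : False := by
  obtain ⟨j, a1, a2, a3⟩ := big hπ hU i hi
  obtain ⟨m, b1, b2, b3⟩ := big hπ hU k hk
  have a4 := threeUV hπ hV i o j hi (by omega) a1 a2
  have b4 := threeUV hπ hV k o m hk (by omega) b1 b2
  have := four hπ i k hik j m hi hk a1 a2 b1 b2
  omega

lemma nec2 {π : ThetaVert p ℓ → ℕ} (hπ : IsPackingColoring (thetaGraph p ℓ) 4 π)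
    (hU : π (thetaU p ℓ) = 2) (hV : π (thetaV p ℓ) = 3)
    (i k o : Fin p) (hik : i ≠ k) (hio : i ≠ o) (hko : k ≠ o) (hi : 3 ≤ ℓ i) (hk : 3 ≤ ℓ k)
    (hi' : ℓ i ≤ 5) (hk' : ℓ k ≤ 5) (ho : 1 ≤ ℓ o) : False := by
  obtain ⟨j, a1, a2, a3⟩ := big hπ hU i hi
  obtain ⟨m, b1, b2, b3⟩ := big hπ hU k hk
  have a4 := threeV hπ hV i j hi a1 a2
  have b4 := threeV hπ hV k m hk b1 b2
  have a5 := threeUV hπ hV i o j hi ho a1 a2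
  have b5 := threeUV hπ hV k o m hk ho b1 b2
  have c1 := four hπ i k hik j m hi hk a1 a2 b1 b2
  have c2 := three hπ i k hik j m hi hk a1 a2 b1 b2
  by_cases h : 3 ≤ ℓ o
  · obtain ⟨n, d1, d2, d3⟩ := big hπ hU o h
    have e1 := four hπ i o hio j n hi h a1 a2 d1 d2
    have e2 := three hπ i o hio j n hi h a1 a2 d1 d2
    have e3 := four hπ k o hko m n hk h b1 b2 d1 d2
    have e4 := three hπ k o hko m n hk h b1 b2 d1 d2
    clear hU hV
    rcases a3 with a3 | a3 <;> rcases b3 with b3 | b3 <;> rcases d3 with d3 | d3 <;>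
      simp only [a3, b3, d3, true_and, and_true, not_true, forall_true_left] at * <;> omega
  · clear hU hV
    rcases a3 with a3 | a3 <;> rcases b3 with b3 | b3 <;>
      simp only [a3, b3, true_and, and_true, not_true, forall_true_left] at * <;> omega

lemma count_sum : pathCount p ℓ 3 + pathCount p ℓ 4 + pathCount p ℓ 5 =
    (Finset.univ.filter (fun i : Fin p => 3 ≤ ℓ i ∧ ℓ i ≤ 5)).card := by
  simp only [pathCount, Finset.card_filter, ← Finset.sum_add_distrib]
  apply Finset.sum_congr rfl
  intro i _
  split_ifs <;> omega

lemma exists_third (hp : 3 ≤ p) (i k : Fin p) : ∃ o, i ≠ o ∧ k ≠ o := by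
  obtain ⟨o, ho⟩ : ∃ o, o ∉ ({i, k} : Finset (Fin p)) := by
    by_contra h
    push Not at h
    have h1 : (Finset.univ : Finset (Fin p)).card ≤ ({i, k} : Finset (Fin p)).card :=
      Finset.card_le_card (fun x _ => h x)
    have h2 : ({i, k} : Finset (Fin p)).card ≤ 2 := Finset.card_le_two
    simp at h1
    omega
  simp only [Finset.mem_insert, Finset.mem_singleton, not_or] at ho
  exact ⟨o, fun h => ho.1 h.symm, fun h => ho.2 h.symm⟩

end ThetaAux

open ThetaAux

theorem stmt9 (p : ℕ) (ℓ : Fin p → ℕ) (hp : 3 ≤ p)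
    (hmono : Monotone ℓ) (hpos : ∀ i, 1 ≤ ℓ i) (hsimple : 2 ≤ ℓ ⟨1, by omega⟩) :
    (∃ π : ThetaVert p ℓ → ℕ, IsPackingColoring (thetaGraph p ℓ) 4 π ∧ π (thetaU p ℓ) = 2 ∧ π (thetaV p ℓ) = 3) ↔
      ((pathCount p ℓ 1 ≤ 1 ∧ longPathCount p ℓ ≤ 1) ∨
       (pathCount p ℓ 1 = 0 ∧ pathCount p ℓ 3 + pathCount p ℓ 4 + pathCount p ℓ 5 ≤ 1)) := by
  have hn0 : pathCount p ℓ 1 = 0 ↔ ∀ i, ℓ i ≠ 1 := by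
    simp [pathCount, Finset.filter_eq_empty_iff]
  have hn1 : pathCount p ℓ 1 ≤ 1 := by
    rw [pathCount, Finset.card_le_one]
    have key : ∀ i : Fin p, ℓ i = 1 → (i : ℕ) = 0 := by
      intro i hi
      by_contra h
      have : ℓ ⟨1, by omega⟩ ≤ ℓ i := hmono (by rw [Fin.le_def]; simp only; omega)
      omega
    intro a ha b hb
    simp only [Finset.mem_filter, Finset.mem_univ, true_and] at ha hb
    exact Fin.ext ((key a ha).trans (key b hb).symm)
  rw [count_sum, hn0]
  constructor
  · rintro ⟨π, hπ, hU, hV⟩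
    by_cases h : ∀ i, ℓ i ≠ 1
    · refine Or.inr ⟨h, ?_⟩
      rw [Finset.card_le_one]
      intro a ha b hb
      simp only [Finset.mem_filter, Finset.mem_univ, true_and] at ha hb
      by_contra hab
      obtain ⟨o, h1, h2⟩ := exists_third hp a b
      exact nec2 hπ hU hV a b o hab h1 h2 ha.1 hb.1 ha.2 hb.2 (hpos o)
    · refine Or.inl ⟨hn1, ?_⟩
      push Not at h
      obtain ⟨o, ho⟩ := h
      rw [longPathCount, Finset.card_le_one]
      intro a ha b hb
      simp only [Finset.mem_filter, Finset.mem_univ, true_and] at ha hb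
      by_contra hab
      exact nec1 hπ hU hV a b o hab ha hb ho
  · rintro (⟨_, h⟩ | ⟨h0, h⟩)
    · refine ⟨mkCol cI, caseI hpos ?_, rfl, rfl⟩
      rw [longPathCount, Finset.card_le_one] at h
      rintro i i' hne ⟨h1, h2⟩
      exact hne (h i (by simpa using h1) i' (by simpa using h2))
    · refine ⟨mkCol cII, caseII ?_ ?_, rfl, rfl⟩
      · intro i
        have := hpos i
        have := h0 i
        omega
      · rw [Finset.card_le_one] at h
        rintro i i' hne ⟨h1, h2, h3, h4⟩
        exact hne (h i (by simpa using ⟨h1, h2⟩) i' (by simpa using ⟨h3, h4⟩))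
end

section
/- If a generalized theta graph Θ = Θ_{ℓ1,…,ℓp} with p ≥ 3 admits a packing 4-coloring π with π(u) = 1, then p = 3. -/
/-- The internal vertex adjacent to `u` on the `i`-th path. -/
def firstInner (p : ℕ) (ℓ : Fin p → ℕ) (i : Fin p) (h : 2 ≤ ℓ i) : ThetaVert p ℓ :=
  Sum.inr ⟨i, ⟨0, by omega⟩⟩

/-- The neighbor of `u` on the `i`-th path. -/
def nbU (p : ℕ) (ℓ : Fin p → ℕ) (i : Fin p) : ThetaVert p ℓ :=
  if h : 2 ≤ ℓ i then firstInner p ℓ i h else thetaV p ℓ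

theorem nbU_adj (p : ℕ) (ℓ : Fin p → ℕ) (hpos : ∀ i, 1 ≤ ℓ i) (i : Fin p) :
    (thetaGraph p ℓ).Adj (thetaU p ℓ) (nbU p ℓ i) := by
  unfold thetaGraph
  rw [SimpleGraph.fromRel_adj]
  by_cases h : 2 ≤ ℓ i
  · rw [nbU, dif_pos h]
    exact ⟨(fun e => by cases e), Or.inl (Or.inl ⟨rfl, rfl⟩)⟩
  · rw [nbU, dif_neg h]
    have := hpos i
    exact ⟨(fun e => by cases e), Or.inl ⟨rfl, rfl, i, by omega⟩⟩

theorem nbU_inj (p : ℕ) (ℓ : Fin p → ℕ)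
    (hmono : Monotone ℓ) (k : Fin p) (hk : (k : ℕ) = 1) (hsimple : 2 ≤ ℓ k) :
    Function.Injective (nbU p ℓ) := by
  have key : ∀ i : Fin p, ¬ 2 ≤ ℓ i → (i : ℕ) = 0 := by
    intro i hi
    by_contra h0
    have : k ≤ i := by
      rw [Fin.le_def]; omega
    have := hmono this
    omega
  intro i j hij
  by_cases h1 : 2 ≤ ℓ i <;> by_cases h2 : 2 ≤ ℓ j
  · rw [nbU, dif_pos h1, nbU, dif_pos h2] at hij
    have := Sum.inr.inj hij
    exact congrArg Sigma.fst this
  · rw [nbU, dif_pos h1, nbU, dif_neg h2] at hij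
    cases hij
  · rw [nbU, dif_neg h1, nbU, dif_pos h2] at hij
    cases hij
  · have := key i h1
    have := key j h2
    exact Fin.ext (by omega)

theorem stmt11 (p : ℕ) (ℓ : Fin p → ℕ) (hp : 3 ≤ p)
    (hmono : Monotone ℓ) (hpos : ∀ i, 1 ≤ ℓ i) (hsimple : 2 ≤ ℓ ⟨1, by omega⟩)
    (h : ∃ π : ThetaVert p ℓ → ℕ, IsPackingColoring (thetaGraph p ℓ) 4 π ∧
      π (thetaU p ℓ) = 1) :
    p = 3 := by
  obtain ⟨π, ⟨hr, hd⟩, hu⟩ := h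
  have hadj := nbU_adj p ℓ hpos
  have hinj := nbU_inj p ℓ hmono _ rfl hsimple
  have hge : ∀ i, 2 ≤ π (nbU p ℓ i) := by
    intro i
    by_contra hlt
    have h1 : π (nbU p ℓ i) = 1 := by have := (hr (nbU p ℓ i)).1; omega
    have := hd _ _ (hadj i).ne (hu.trans h1.symm)
    have h2 := (SimpleGraph.Walk.cons (hadj i) SimpleGraph.Walk.nil).edist_le
    have h3 := this.trans_le h2
    rw [hu] at h3
    simp at h3
  have hcinj : Function.Injective (fun i => π (nbU p ℓ i)) := by
    intro i j hij
    by_contra hne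
    have := hd _ _ (fun e => hne (hinj e)) hij
    have h2 := (SimpleGraph.Walk.cons (hadj i).symm
      (SimpleGraph.Walk.cons (hadj j) SimpleGraph.Walk.nil)).edist_le
    have h3 := this.trans_le h2
    have h4 := Nat.cast_lt.mp h3
    have := hge i
    simp only [SimpleGraph.Walk.length_cons, SimpleGraph.Walk.length_nil] at h4
    omega
  have hcard := Finset.card_le_card_of_injOn (s := (Finset.univ : Finset (Fin p)))
    (t := Finset.Icc 2 4) (fun i => π (nbU p ℓ i))
    (fun i _ => by simpa using ⟨hge i, (hr _).2⟩) hcinj.injOn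
  simp at hcard
  omega
end

section
/- If Θ = Θ_{ℓ1,ℓ2,ℓ3} is a generalized theta graph on three paths and π is a packing 4-coloring of Θ with π(u) = 1, then Θ satisfies at least one of the conditions (A)–(N). -/
theorem aux_two {V : Type*} {G : SimpleGraph V} {k : ℕ} {π : V → ℕ}
    (h : IsPackingColoring G k π) {x y : V} (w : G.Walk x y) (hne : x ≠ y)
    (hc : π x = π y) : π x < w.length := by
  have h1 := h.2 x y hne hc
  have h2 : G.edist x y ≤ (w.length : ℕ∞) := w.edist_le
  exact_mod_cast lt_of_lt_of_le h1 h2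

theorem aux_count (ℓ : Fin 3 → ℕ) (m : ℕ) : pathCount 3 ℓ m =
    (if ℓ 0 = m then 1 else 0) + (if ℓ 1 = m then 1 else 0) + (if ℓ 2 = m then 1 else 0) := by
  simp only [pathCount, Finset.card_filter, Fin.sum_univ_three]

theorem aux_long (ℓ : Fin 3 → ℕ) : longPathCount 3 ℓ =
    (if 3 ≤ ℓ 0 then 1 else 0) + (if 3 ≤ ℓ 1 then 1 else 0) + (if 3 ≤ ℓ 2 then 1 else 0) := by
  simp only [longPathCount, Finset.card_filter, Fin.sum_univ_three]

/-- The graph `Θ_{3,3,3}` has no packing 4-coloring with `π u = 1`. -/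
theorem aux_333 (π : ThetaVert 3 (fun _ => 3) → ℕ)
    (h : IsPackingColoring (thetaGraph 3 (fun _ => 3)) 4 π)
    (hu : π (thetaU 3 (fun _ => 3)) = 1) : False := by
  set G := thetaGraph 3 (fun _ => 3) with hG
  let u : ThetaVert 3 (fun _ => 3) := Sum.inl false
  let v : ThetaVert 3 (fun _ => 3) := Sum.inl true
  let x : Fin 3 → ThetaVert 3 (fun _ => 3) := fun i => Sum.inr ⟨i, (0 : Fin 2)⟩
  let y : Fin 3 → ThetaVert 3 (fun _ => 3) := fun i => Sum.inr ⟨i, (1 : Fin 2)⟩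
  have hux : ∀ i, G.Adj u (x i) := fun i => by
    refine (SimpleGraph.fromRel_adj _ _ _).2 ⟨Sum.inl_ne_inr, Or.inl (Or.inl ⟨rfl, rfl⟩)⟩
  have hvy : ∀ i, G.Adj v (y i) := fun i => by
    refine (SimpleGraph.fromRel_adj _ _ _).2 ⟨Sum.inl_ne_inr, Or.inl (Or.inr ⟨rfl, rfl⟩)⟩
  have hyx : ∀ i j, y i ≠ x j := fun i j e => by
    have h1 := Sum.inr.inj e
    obtain ⟨h2, h3⟩ := Sigma.mk.inj h1
    subst h2
    exact absurd (eq_of_heq h3) (show ¬ ((1 : Fin 2) = 0) by decide)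
  have hxy : ∀ i, G.Adj (x i) (y i) := fun i => by
    refine (SimpleGraph.fromRel_adj _ _ _).2 ⟨(hyx i i).symm, Or.inl ⟨rfl, rfl⟩⟩
  have hxx : ∀ i j, i ≠ j → x i ≠ x j := fun i j hij e =>
    hij (Sigma.mk.inj (Sum.inr.inj e)).1
  have hyy : ∀ i j, i ≠ j → y i ≠ y j := fun i j hij e =>
    hij (Sigma.mk.inj (Sum.inr.inj e)).1
  have huu : π u = 1 := hu
  -- the neighbours of `u` do not have color 1
  have x1 : ∀ i, π (x i) ≠ 1 := fun i e => by
    have := aux_two h (hux i).toWalk (hux i).ne (by omega)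
    simp at this
    omega
  -- distinct neighbours of `u` have distinct colors
  have xd : ∀ i j, i ≠ j → π (x i) ≠ π (x j) := fun i j hij e => by
    have := aux_two h (.cons (hux i).symm (hux j).toWalk) (hxx i j hij) e
    have h1 := x1 i
    have h2 := (h.1 (x i)).1
    simp at this
    omega
  -- hence `v` has color 1
  have vx : ∀ i, π v ≠ 1 → π v ≠ π (x i) := fun i h1 e => by
    have := aux_two h (.cons (hvy i) (hxy i).symm.toWalk) Sum.inl_ne_inr e
    have h2 := (h.1 v).1
    simp at this
    omega
  have b := fun i => h.1 (x i)
  have bv := h.1 v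
  have hby := fun i => h.1 (y i)
  have d01 := xd 0 1 (by decide)
  have d02 := xd 0 2 (by decide)
  have d12 := xd 1 2 (by decide)
  have hv : π v = 1 := by
    by_contra hv
    have := vx 0 hv
    have := vx 1 hv
    have := vx 2 hv
    have := b 0
    have := b 1
    have := b 2
    have := x1 0
    have := x1 1
    have := x1 2
    omega
  have y1 : ∀ i, π (y i) ≠ 1 := fun i e => by
    have := aux_two h (hvy i).toWalk (hvy i).ne (by omega)
    simp at this
    omega
  have yd : ∀ i j, i ≠ j → π (y i) ≠ π (y j) := fun i j hij e => by
    have := aux_two h (.cons (hvy i).symm (hvy j).toWalk) (hyy i j hij) e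
    have h1 := y1 i
    have h2 := (h.1 (y i)).1
    simp at this
    omega
  -- color 3 appears once among the neighbours of `u` and once among those of `v`
  have hx3 : ∃ i, π (x i) = 3 := by
    by_contra! hn
    have := b 0
    have := b 1
    have := b 2
    have := x1 0
    have := x1 1
    have := x1 2
    have := hn 0
    have := hn 1
    have := hn 2
    omega
  have hy3 : ∃ i, π (y i) = 3 := by
    by_contra! hn
    have := hby 0
    have := hby 1
    have := hby 2
    have := y1 0
    have := y1 1
    have := y1 2
    have := hn 0
    have := hn 1
    have := hn 2
    have := yd 0 1 (by decide)
    have := yd 0 2 (by decide)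
    have := yd 1 2 (by decide)
    omega
  obtain ⟨i, hi⟩ := hx3
  obtain ⟨j, hj⟩ := hy3
  have := aux_two h (.cons (hxy j).symm (.cons (hux j).symm (hux i).toWalk)) (hyx j i) (by omega)
  simp at this
  omega

set_option maxHeartbeats 4000000 in
theorem stmt12 (ℓ : Fin 3 → ℕ)
    (hmono : Monotone ℓ) (hpos : ∀ i, 1 ≤ ℓ i) (hsimple : 2 ≤ ℓ 1)
    (h : ∃ π : ThetaVert 3 ℓ → ℕ, IsPackingColoring (thetaGraph 3 ℓ) 4 π ∧
      π (thetaU 3 ℓ) = 1) :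
    CondAN 3 ℓ := by
  have h01 : ℓ 0 ≤ ℓ 1 := hmono (by decide)
  have h12 : ℓ 1 ≤ ℓ 2 := hmono (by decide)
  have hp0 := hpos 0
  have hne : ¬ (ℓ 0 = 3 ∧ ℓ 1 = 3 ∧ ℓ 2 = 3) := by
    rintro ⟨e0, e1, e2⟩
    have he : ℓ = fun _ => 3 := by
      funext i
      fin_cases i <;> assumption
    subst he
    obtain ⟨π, hπ, hu⟩ := h
    exact aux_333 π hπ hu
  clear h hmono hpos
  simp only [CondAN, aux_count, aux_long]
  generalize ℓ 0 = a at *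
  generalize ℓ 1 = b at *
  generalize ℓ 2 = c at *
  have cases9 : ∀ t : ℕ, 1 ≤ t → t = 1 ∨ t = 2 ∨ t = 3 ∨ t = 4 ∨ t = 5 ∨ t = 6 ∨ t = 7 ∨ t = 8 ∨
      (t ≠ 1 ∧ t ≠ 2 ∧ t ≠ 3 ∧ t ≠ 4 ∧ t ≠ 5 ∧ t ≠ 6 ∧ t ≠ 7 ∧ t ≠ 8 ∧ 3 ≤ t) := by omega
  have ha := cases9 a hp0
  have hb := cases9 b (by omega)
  have hc := cases9 c (by omega)
  clear cases9
  rcases ha with rfl | rfl | rfl | rfl | rfl | rfl | rfl | rfl | ha <;>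
  rcases hb with rfl | rfl | rfl | rfl | rfl | rfl | rfl | rfl | hb <;>
  first
  | (exfalso; omega)
  | (rcases hc with rfl | rfl | rfl | rfl | rfl | rfl | rfl | rfl | hc <;>
      first
      | (exfalso; omega)
      | simp [*])
end

section
/- For every orientation →Θ of a generalized theta graph Θ_{ℓ1,…,ℓp} with p ≥ 2, the packing chromatic number satisfies 2 ≤ χρ(→Θ) ≤ 5. -/
open Classical in
/-- color of the internal vertices: `P` and `Q` tell whether the first (last) edge leaves `u` (`v`) -/
noncomputable def thCol (L : ℕ) (P Q : Prop) (j : ℕ) : ℕ :=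
  if L = 3 then
    (if P then (if j = 0 then 2 else 1)
     else if Q then (if j = 0 then 1 else 2)
     else (if j = 0 then 3 else 1))
  else if L % 2 = 0 then
    (if j % 2 = 0 then 1 else if j % 4 = 1 then 2 else 3)
  else if j = 0 then 1 else if j = 1 then 2
  else if j % 2 = 1 then 1 else if j % 4 = 0 then 2 else 3

lemma thCol_bd (L : ℕ) (P Q : Prop) (j : ℕ) : 1 ≤ thCol L P Q j ∧ thCol L P Q j ≤ 3 := by
  unfold thCol; split_ifs <;> first | omega | simp_all

lemma thCol_succ (L : ℕ) (P Q : Prop) (j : ℕ) (h : j + 2 < L) :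
    thCol L P Q j ≠ thCol L P Q (j + 1) := by
  unfold thCol; split_ifs <;> first | omega | simp_all

lemma thCol_two (L : ℕ) (P Q : Prop) (j : ℕ) (h : j + 3 < L)
    (e : thCol L P Q j = thCol L P Q (j + 2)) : thCol L P Q j = 1 := by
  revert e; unfold thCol; split_ifs <;> first | omega | simp_all

lemma thCol_three (L : ℕ) (P Q : Prop) (j : ℕ) (h : j + 4 < L)
    (e : thCol L P Q j = thCol L P Q (j + 3)) : thCol L P Q j ≠ 3 := by
  revert e; unfold thCol; split_ifs <;> first | omega | simp_all

lemma thCol_u2 (L : ℕ) (P Q : Prop) (h : thCol L P Q 0 = 2) : P := by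
  revert h; unfold thCol; split_ifs <;> first | omega | tauto

lemma thCol_u3 (L : ℕ) (P Q : Prop) (h : thCol L P Q 0 = 3) : ¬ P := by
  revert h; unfold thCol; split_ifs <;> first | omega | tauto

lemma thCol_v2 (L : ℕ) (P Q : Prop) (j : ℕ) (hj : j + 2 = L) (h : thCol L P Q j = 2) : Q := by
  revert h; unfold thCol; split_ifs <;> first | omega | tauto

lemma thCol_v3 (L : ℕ) (P Q : Prop) (j : ℕ) (hj : j + 2 = L) : thCol L P Q j ≠ 3 := by
  unfold thCol; split_ifs <;> first | omega | simp_all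

lemma thCol_13 (L : ℕ) (P Q : Prop) : thCol L P Q 1 ≠ 3 := by
  unfold thCol; split_ifs <;> first | omega | simp_all

section
variable {p : ℕ} {ℓ : Fin p → ℕ}

def tE (p : ℕ) (ℓ : Fin p → ℕ) (a : Bool) : ThetaVert p ℓ := Sum.inl a
def tI (i : Fin p) (j : Fin (ℓ i - 1)) : ThetaVert p ℓ := Sum.inr ⟨i, j⟩

lemma tv_cases (x : ThetaVert p ℓ) : (∃ a, x = tE p ℓ a) ∨ ∃ i j, x = tI i j := by
  rcases x with a | ⟨i, j⟩
  · exact Or.inl ⟨a, rfl⟩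
  · exact Or.inr ⟨i, j, rfl⟩

noncomputable def thPi (A : ThetaVert p ℓ → ThetaVert p ℓ → Prop) : ThetaVert p ℓ → ℕ
  | Sum.inl false => 4
  | Sum.inl true => 5
  | Sum.inr ⟨i, j⟩ => thCol (ℓ i)
      (∃ k : Fin (ℓ i - 1), (k : ℕ) = 0 ∧ A (tE p ℓ false) (tI i k))
      (∃ k : Fin (ℓ i - 1), (k : ℕ) + 2 = ℓ i ∧ A (tE p ℓ true) (tI i k)) j

variable {A : ThetaVert p ℓ → ThetaVert p ℓ → Prop}

lemma thPi_E (a b : Bool) (h : thPi A (tE p ℓ a) = thPi A (tE p ℓ b)) : a = b := by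
  cases a <;> cases b <;> simp [thPi, tE] at h ⊢

lemma thPi_E_ge (a : Bool) : 4 ≤ thPi A (tE p ℓ a) ∧ thPi A (tE p ℓ a) ≤ 5 := by
  cases a <;> simp [thPi, tE]

lemma thPi_I_le (i : Fin p) (j : Fin (ℓ i - 1)) : 1 ≤ thPi A (tI i j) ∧ thPi A (tI i j) ≤ 3 :=
  thCol_bd _ _ _ _

lemma arc_adj (hA : IsOrientation (thetaGraph p ℓ) A) {x y : ThetaVert p ℓ} (h : A x y) :
    x ≠ y ∧ (thetaRel p ℓ x y ∨ thetaRel p ℓ y x) := by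
  have := (hA.1 x y).2 (Or.inl h)
  simpa [thetaGraph, SimpleGraph.fromRel_adj] using this

lemma arc_EE (hA : IsOrientation (thetaGraph p ℓ) A) {a b : Bool}
    (h : A (tE p ℓ a) (tE p ℓ b)) : a ≠ b := by
  intro e; subst e; exact (arc_adj hA h).1 rfl

lemma arc_EI (hA : IsOrientation (thetaGraph p ℓ) A) {a : Bool} {i : Fin p} {j : Fin (ℓ i - 1)}
    (h : A (tE p ℓ a) (tI i j)) : (a = false ∧ (j : ℕ) = 0) ∨ (a = true ∧ (j : ℕ) + 2 = ℓ i) := by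
  rcases (arc_adj hA h).2 with h | h
  · exact h
  · exact h.elim

lemma arc_IE (hA : IsOrientation (thetaGraph p ℓ) A) {a : Bool} {i : Fin p} {j : Fin (ℓ i - 1)}
    (h : A (tI i j) (tE p ℓ a)) : (a = false ∧ (j : ℕ) = 0) ∨ (a = true ∧ (j : ℕ) + 2 = ℓ i) := by
  rcases (arc_adj hA h).2 with h | h
  · exact h.elim
  · exact h

lemma arc_II (hA : IsOrientation (thetaGraph p ℓ) A) {i i' : Fin p} {j : Fin (ℓ i - 1)}
    {j' : Fin (ℓ i' - 1)} (h : A (tI i j) (tI i' j')) :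
    i = i' ∧ ((j : ℕ) + 1 = j' ∨ (j' : ℕ) + 1 = j) := by
  rcases (arc_adj hA h).2 with h | h
  · exact ⟨Fin.ext h.1, Or.inl h.2⟩
  · exact ⟨Fin.ext h.1.symm, Or.inr h.2⟩

lemma pi_I (i : Fin p) (j : Fin (ℓ i - 1)) : thPi A (tI i j) = thCol (ℓ i)
      (∃ k : Fin (ℓ i - 1), (k : ℕ) = 0 ∧ A (tE p ℓ false) (tI i k))
      (∃ k : Fin (ℓ i - 1), (k : ℕ) + 2 = ℓ i ∧ A (tE p ℓ true) (tI i k)) j := rfl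

lemma fact_u2 {i : Fin p} {j : Fin (ℓ i - 1)} (hj : (j : ℕ) = 0) (h : thPi A (tI i j) = 2) :
    A (tE p ℓ false) (tI i j) := by
  rw [pi_I, hj] at h
  obtain ⟨k, hk, h⟩ := thCol_u2 _ _ _ h
  have : k = j := Fin.ext (by omega)
  rwa [this] at h

lemma fact_u3 {i : Fin p} {j : Fin (ℓ i - 1)} (hj : (j : ℕ) = 0) (h : thPi A (tI i j) = 3) :
    ¬ A (tE p ℓ false) (tI i j) := by
  rw [pi_I, hj] at h
  exact fun h' => thCol_u3 _ _ _ h ⟨j, hj, h'⟩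

lemma fact_v2 {i : Fin p} {j : Fin (ℓ i - 1)} (hj : (j : ℕ) + 2 = ℓ i)
    (h : thPi A (tI i j) = 2) : A (tE p ℓ true) (tI i j) := by
  rw [pi_I] at h
  obtain ⟨k, hk, h⟩ := thCol_v2 _ _ _ _ hj h
  have : k = j := Fin.ext (by omega)
  rwa [this] at h

lemma fact_v3 {i : Fin p} {j : Fin (ℓ i - 1)} (hj : (j : ℕ) + 2 = ℓ i) :
    thPi A (tI i j) ≠ 3 := thCol_v3 _ _ _ _ hj

lemma fact_13 {i : Fin p} {j : Fin (ℓ i - 1)} (hj : (j : ℕ) = 1) :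
    thPi A (tI i j) ≠ 3 := by rw [pi_I, hj]; exact thCol_13 _ _ _

lemma fact_d1 {i : Fin p} {j k : Fin (ℓ i - 1)} (hj : (j : ℕ) + 1 = k) :
    thPi A (tI i j) ≠ thPi A (tI i k) := by
  rw [pi_I, pi_I, ← hj]; exact thCol_succ _ _ _ _ (by omega)

lemma fact_d2 {i : Fin p} {j k : Fin (ℓ i - 1)} (hj : (j : ℕ) + 2 = k)
    (h : thPi A (tI i j) = thPi A (tI i k)) : thPi A (tI i j) = 1 := by
  rw [pi_I, pi_I, ← hj] at h; exact thCol_two _ _ _ _ (by omega) h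

lemma fact_d3 {i : Fin p} {j k : Fin (ℓ i - 1)} (hj : (j : ℕ) + 3 = k)
    (h : thPi A (tI i j) = thPi A (tI i k)) : thPi A (tI i j) ≠ 3 := by
  rw [pi_I, pi_I, ← hj] at h; exact thCol_three _ _ _ _ (by omega) h

lemma walk1 (hA : IsOrientation (thetaGraph p ℓ) A) {x y : ThetaVert p ℓ} (h : A x y) :
    thPi A x ≠ thPi A y := by
  rcases tv_cases x with ⟨a, rfl⟩ | ⟨i, j, rfl⟩ <;>
    rcases tv_cases y with ⟨b, rfl⟩ | ⟨i', j', rfl⟩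
  · exact fun e => arc_EE hA h (thPi_E _ _ e)
  · have := thPi_E_ge (A := A) a; have := thPi_I_le (A := A) i' j'; omega
  · have := thPi_E_ge (A := A) b; have := thPi_I_le (A := A) i j; omega
  · obtain ⟨rfl, h | h⟩ := arc_II hA h
    · exact fact_d1 h
    · exact (fact_d1 h).symm

lemma same_I {x y : ThetaVert p ℓ} (hxy : x ≠ y) (e : thPi A x = thPi A y) :
    (∃ i j, x = tI i j) ∧ ∃ i j, y = tI i j := by
  rcases tv_cases x with ⟨a, rfl⟩ | ⟨i, j, rfl⟩ <;>
    rcases tv_cases y with ⟨b, rfl⟩ | ⟨i', j', rfl⟩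
  · exact (hxy (by rw [thPi_E _ _ e])).elim
  · have := thPi_E_ge (A := A) a; have := thPi_I_le (A := A) i' j'; omega
  · have := thPi_E_ge (A := A) b; have := thPi_I_le (A := A) i j; omega
  · exact ⟨⟨i, j, rfl⟩, i', j', rfl⟩

lemma walk2 (hA : IsOrientation (thetaGraph p ℓ) A) {x y z : ThetaVert p ℓ} (hxy : x ≠ y)
    (h1 : A x z) (h2 : A z y) (e : thPi A x = thPi A y) : thPi A x = 1 := by
  obtain ⟨⟨i, j, rfl⟩, i', j', rfl⟩ := same_I hxy e
  have hb := thPi_I_le (A := A) i j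
  rcases tv_cases z with ⟨a, rfl⟩ | ⟨k, l, rfl⟩
  · by_contra hne
    have h23 : thPi A (tI i j) = 2 ∨ thPi A (tI i j) = 3 := by omega
    rcases arc_IE hA h1 with ⟨rfl, hj⟩ | ⟨rfl, hj⟩ <;>
      rcases arc_EI hA h2 with ⟨ha, hj'⟩ | ⟨ha, hj'⟩ <;> try simp at ha
    · rcases h23 with h | h
      · exact hA.2 _ _ h1 (fact_u2 hj h)
      · exact fact_u3 hj' (e ▸ h) h2
    · rcases h23 with h | h
      · exact hA.2 _ _ h1 (fact_v2 hj h)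
      · exact fact_v3 hj h
  · obtain ⟨rfl, h1'⟩ := arc_II hA h1
    obtain ⟨rfl, h2'⟩ := arc_II hA h2
    have hjj : (j : ℕ) ≠ j' := fun h => hxy (by rw [Fin.ext h])
    have : (j : ℕ) + 2 = j' ∨ (j' : ℕ) + 2 = j := by omega
    rcases this with h | h
    · exact fact_d2 h e
    · rw [e]; exact fact_d2 h e.symm

lemma walk3 (hA : IsOrientation (thetaGraph p ℓ) A) {x y z w : ThetaVert p ℓ} (hxy : x ≠ y)
    (h1 : A x z) (h2 : A z w) (h3 : A w y) (e : thPi A x = thPi A y) : thPi A x ≠ 3 := by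
  obtain ⟨⟨i, j, rfl⟩, i', j', rfl⟩ := same_I hxy e
  intro hx
  have hy : thPi A (tI i' j') = 3 := e ▸ hx
  rcases tv_cases z with ⟨a, rfl⟩ | ⟨k, l, rfl⟩
  · rcases arc_IE hA h1 with ⟨rfl, hj⟩ | ⟨rfl, hj⟩
    · rcases tv_cases w with ⟨b, rfl⟩ | ⟨k, l, rfl⟩
      · have hb := arc_EE hA h2
        rcases arc_EI hA h3 with ⟨rfl, hj'⟩ | ⟨rfl, hj'⟩
        · exact hb rfl
        · exact fact_v3 hj' hy
      · obtain ⟨rfl, h3'⟩ := arc_II hA h3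
        rcases arc_EI hA h2 with ⟨_, hl⟩ | ⟨hf, _⟩
        · exact fact_13 (by omega) hy
        · simp at hf
    · exact fact_v3 hj hx
  · obtain ⟨rfl, h1'⟩ := arc_II hA h1
    rcases tv_cases w with ⟨b, rfl⟩ | ⟨k, l', rfl⟩
    · rcases arc_EI hA h3 with ⟨rfl, hj'⟩ | ⟨rfl, hj'⟩
      · rcases arc_IE hA h2 with ⟨_, hl⟩ | ⟨hf, _⟩
        · exact fact_13 (by omega) hx
        · simp at hf
      · exact fact_v3 hj' hy
    · obtain ⟨rfl, h2'⟩ := arc_II hA h2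
      obtain ⟨rfl, h3'⟩ := arc_II hA h3
      have : (j : ℕ) + 3 = j' ∨ (j' : ℕ) + 3 = j ∨ (j : ℕ) + 1 = j' ∨ (j' : ℕ) + 1 = j := by omega
      rcases this with h | h | h | h
      · exact fact_d3 h e hx
      · exact fact_d3 h e.symm hy
      · exact fact_d1 h e
      · exact fact_d1 h e.symm

lemma no_walk (hA : IsOrientation (thetaGraph p ℓ) A) {x y : ThetaVert p ℓ} (hxy : x ≠ y)
    (e : thPi A x = thPi A y) (m : ℕ) (h : DirPath A m x y) : thPi A x < m := by
  have hb : thPi A x ≤ 3 := by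
    obtain ⟨⟨i, j, rfl⟩, -⟩ := same_I hxy e
    exact (thPi_I_le i j).2
  match m, h with
  | 0, h => exact (hxy h).elim
  | 1, ⟨z, h1, h2⟩ =>
    change z = y at h2
    subst h2
    exact (walk1 hA h1 e).elim
  | 2, ⟨z, h1, w, h2, h3⟩ =>
    change w = y at h3
    subst h3
    have := walk2 hA hxy h1 h2 e
    omega
  | 3, ⟨z, h1, w, h2, t, h3, h4⟩ =>
    change t = y at h4
    subst h4
    have := walk3 hA hxy h1 h2 h3 e
    omega
  | m + 4, _ => omega

lemma good_coloring (hA : IsOrientation (thetaGraph p ℓ) A) :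
    IsDirPackingColoring A 5 (thPi A) := by
  refine ⟨fun x => ?_, fun x y hxy e => ?_⟩
  · rcases tv_cases x with ⟨a, rfl⟩ | ⟨i, j, rfl⟩
    · have := thPi_E_ge (A := A) a; omega
    · have := thPi_I_le (A := A) i j; omega
  · have : ((thPi A x + 1 : ℕ) : ℕ∞) ≤ weakEDist A x y := by
      refine le_sInf ?_
      rintro n ⟨m, h | h, rfl⟩
      · exact_mod_cast no_walk hA hxy e m h
      · have := no_walk hA hxy.symm e.symm m h
        exact_mod_cast (by omega : thPi A x + 1 ≤ m)
    refine lt_of_lt_of_le ?_ this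
    exact_mod_cast Nat.lt_succ_self _

end

theorem stmt14 (p : ℕ) (ℓ : Fin p → ℕ) (hp : 2 ≤ p)
    (hmono : Monotone ℓ) (hpos : ∀ i, 1 ≤ ℓ i) (hsimple : 2 ≤ ℓ ⟨1, by omega⟩)
    (A : ThetaVert p ℓ → ThetaVert p ℓ → Prop)
    (hA : IsOrientation (thetaGraph p ℓ) A) :
    2 ≤ dirPackingChromaticNumber A ∧ dirPackingChromaticNumber A ≤ 5 := by
  have hmem : 5 ∈ {k | ∃ π : ThetaVert p ℓ → ℕ, IsDirPackingColoring A k π} :=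
    ⟨_, good_coloring hA⟩
  refine ⟨?_, Nat.sInf_le hmem⟩
  refine le_csInf ⟨5, hmem⟩ ?_
  rintro k ⟨π, hb, hd⟩
  by_contra hk
  have h1 : ∀ x, π x = 1 := fun x => by have := hb x; omega
  have hadj : (thetaGraph p ℓ).Adj (tE p ℓ false) (tI ⟨1, by omega⟩ ⟨0, by omega⟩) := by
    refine (SimpleGraph.fromRel_adj _ _ _).2 ⟨fun h => ?_, Or.inl (Or.inl ⟨rfl, rfl⟩)⟩
    exact Sum.inl_ne_inr h
  have hw := hd _ _ hadj.ne (by rw [h1, h1])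
  rw [h1] at hw
  refine absurd hw (not_lt.2 (sInf_le ⟨1, ?_, rfl⟩))
  rcases (hA.1 _ _).1 hadj with h | h
  · exact Or.inl ⟨_, h, rfl⟩
  · exact Or.inr ⟨_, h, rfl⟩
end

section
/- Let →Θ0 be the oriented generalized theta graph obtained by identifying (according to their names u and v) the end-vertices of the six directed paths u→x1→x2→x3→x4→v, u→y1→y2→v, u→z1→v, v→x'1→x'2→x'3→x'4→u, v→y'1→y'2→u and v→z'1→u. Then χρ(→Θ0) = 5; in particular, every packing coloring of any oriented graph containing →Θ0 as a subgraph must use at least 5 colors. -/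
/-- Arcs of the oriented generalized theta graph `→Θ0`:
`0 = u`, `1 = v`, `2,3,4,5 = x1,x2,x3,x4`, `6,7 = y1,y2`, `8 = z1`,
`9,10,11,12 = x'1,x'2,x'3,x'4`, `13,14 = y'1,y'2`, `15 = z'1`. -/
def theta0 (a b : Fin 16) : Prop :=
  (a, b) ∈ ([(0, 2), (2, 3), (3, 4), (4, 5), (5, 1),
    (0, 6), (6, 7), (7, 1),
    (0, 8), (8, 1),
    (1, 9), (9, 10), (10, 11), (11, 12), (12, 0),
    (1, 13), (13, 14), (14, 0),
    (1, 15), (15, 0)] : List (Fin 16 × Fin 16))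

/-- The arcs of `theta0`. -/
def arcsL : List (Fin 16 × Fin 16) := [(0, 2), (2, 3), (3, 4), (4, 5), (5, 1),
    (0, 6), (6, 7), (7, 1),
    (0, 8), (8, 1),
    (1, 9), (9, 10), (10, 11), (11, 12), (12, 0),
    (1, 13), (13, 14), (14, 0),
    (1, 15), (15, 0)]

/-- Reachability within at most `m` arcs. -/
def reachB : ℕ → Fin 16 → Fin 16 → Bool
  | 0, x, y => x == y
  | m + 1, x, y => (x == y) || arcsL.any (fun p => p.1 == x && reachB m p.2 y)

theorem reachB_iff (m : ℕ) : ∀ x y, reachB m x y = true ↔ ∃ n ≤ m, DirPath theta0 n x y := by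
  induction m with
  | zero =>
    intro x y
    simp [reachB, DirPath]
  | succ m ih =>
    intro x y
    simp only [reachB, Bool.or_eq_true, beq_iff_eq, List.any_eq_true, Bool.and_eq_true, ih]
    constructor
    · rintro (h | ⟨⟨a, b⟩, hp, rfl, n, hn, h⟩)
      · exact ⟨0, by omega, h⟩
      · exact ⟨n + 1, by omega, b, hp, h⟩
    · rintro ⟨n, hn, h⟩
      cases n with
      | zero => exact Or.inl h
      | succ n =>
        obtain ⟨z, hz, h⟩ := h
        exact Or.inr ⟨(x, z), hz, rfl, n, by omega, h⟩

/-- Table of weak distances (99 on the diagonal). -/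
def wTable : List (List ℕ) :=
  [[99, 2, 1, 2, 3, 3, 1, 2, 1, 3, 3, 2, 1, 2, 1, 1],
   [2, 99, 3, 3, 2, 1, 2, 1, 1, 1, 2, 3, 3, 1, 2, 1],
   [1, 3, 99, 1, 2, 3, 5, 4, 4, 5, 4, 3, 2, 3, 2, 2],
   [2, 3, 1, 99, 1, 2, 6, 5, 5, 4, 5, 4, 3, 4, 3, 3],
   [3, 2, 2, 1, 99, 1, 5, 6, 5, 3, 4, 5, 4, 3, 4, 3],
   [3, 1, 3, 2, 1, 99, 4, 5, 4, 2, 3, 4, 5, 2, 3, 2],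
   [1, 2, 5, 6, 5, 4, 99, 1, 4, 3, 4, 3, 2, 3, 2, 2],
   [2, 1, 4, 5, 6, 5, 1, 99, 4, 2, 3, 4, 3, 2, 3, 2],
   [1, 1, 4, 5, 5, 4, 4, 4, 99, 2, 3, 3, 2, 2, 2, 2],
   [3, 1, 5, 4, 3, 2, 3, 2, 2, 99, 1, 2, 3, 5, 4, 4],
   [3, 2, 4, 5, 4, 3, 4, 3, 3, 1, 99, 1, 2, 6, 5, 5],
   [2, 3, 3, 4, 5, 4, 3, 4, 3, 2, 1, 99, 1, 5, 6, 5],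
   [1, 3, 2, 3, 4, 5, 2, 3, 2, 3, 2, 1, 99, 4, 5, 4],
   [2, 1, 3, 4, 3, 2, 3, 2, 2, 5, 6, 5, 4, 99, 1, 4],
   [1, 2, 2, 3, 4, 3, 2, 3, 2, 4, 5, 6, 5, 1, 99, 4],
   [1, 1, 2, 3, 3, 2, 2, 2, 2, 4, 5, 5, 4, 4, 4, 99]]

/-- Weak distance read from the table. -/
def wd (a b : Fin 16) : ℕ := (wTable.getD a.val []).getD b.val 99

theorem wd_spec : ∀ a b : Fin 16, wd a b < 10 →
    a ≠ b ∧ (reachB (wd a b) a b = true ∨ reachB (wd a b) b a = true) := by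
  decide +kernel

/-- Exhaustive search: `true` when the partial coloring `l` has no extension. -/
def srch : List (Fin 16) → List (Fin 16 × ℕ) → Bool
  | [], _ => false
  | v :: vs, l => [1, 2, 3, 4].all fun c =>
      (l.any fun p => p.2 == c && Nat.ble (wd v p.1) c) || srch vs ((v, c) :: l)

theorem srch_sound (g : Fin 16 → ℕ) (h1 : ∀ a, 1 ≤ g a ∧ g a ≤ 4)
    (h2 : ∀ a b, g a = g b → g a < wd a b) :
    ∀ vs l, (∀ p ∈ l, g p.1 = p.2) → srch vs l = true → False := by
  intro vs
  induction vs with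
  | nil => intro l _ h; simp [srch] at h
  | cons v vs ih =>
    intro l hl h
    rw [srch, List.all_eq_true] at h
    have hc := h (g v) (by have := h1 v; simp; omega)
    rw [Bool.or_eq_true, List.any_eq_true] at hc
    rcases hc with ⟨p, hp, hc⟩ | hc
    · simp only [Bool.and_eq_true, beq_iff_eq, Nat.ble_eq] at hc
      have := h2 v p.1 (by rw [hl p hp, hc.1])
      omega
    · refine ih _ ?_ hc
      intro p hp
      rcases List.mem_cons.1 hp with rfl | hp
      · rfl
      · exact hl p hp

theorem srch_true : srch [0, 1, 8, 15, 6, 7, 13, 14, 2, 5, 3, 4, 9, 10, 11, 12] [] = true := by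
  decide +kernel

theorem DirPath.map_hom {V W : Type*} {A : V → V → Prop} {B : W → W → Prop} (f : V → W)
    (hf : ∀ a b, A a b → B (f a) (f b)) (m : ℕ) :
    ∀ x y, DirPath A m x y → DirPath B m (f x) (f y) := by
  induction m with
  | zero => intro x y h; exact congrArg f h
  | succ m ih =>
    rintro x y ⟨z, hz, h⟩
    exact ⟨f z, hf _ _ hz, ih _ _ h⟩

theorem lower_bound {W : Type*} (B : W → W → Prop) (f : Fin 16 → W) (hf : Function.Injective f)
    (hB : ∀ a b, theta0 a b → B (f a) (f b)) (k : ℕ) (π : W → ℕ)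
    (h : IsDirPackingColoring B k π) : 5 ≤ k := by
  by_contra hk
  refine srch_sound (fun a => π (f a)) (fun a => ?_) (fun a b hab => ?_) _ [] (by simp) srch_true
  · have := h.1 (f a)
    constructor <;> omega
  · have h4 := h.1 (f a)
    by_contra hlt
    simp only [not_lt] at hlt hab
    obtain ⟨hne, hr⟩ := wd_spec a b (by omega)
    have hd := h.2 (f a) (f b) (fun e => hne (hf e)) hab
    have key : ∃ n ≤ wd a b, DirPath B n (f a) (f b) ∨ DirPath B n (f b) (f a) := by
      rcases hr with hr | hr
      · obtain ⟨n, hn, hp⟩ := (reachB_iff _ _ _).1 hr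
        exact ⟨n, hn, Or.inl (hp.map_hom f hB)⟩
      · obtain ⟨n, hn, hp⟩ := (reachB_iff _ _ _).1 hr
        exact ⟨n, hn, Or.inr (hp.map_hom f hB)⟩
    obtain ⟨n, hn, hp⟩ := key
    have hle : weakEDist B (f a) (f b) ≤ (n : ℕ∞) := sInf_le ⟨n, hp, rfl⟩
    have : (π (f a) : ℕ∞) < (n : ℕ∞) := lt_of_lt_of_le hd hle
    have : π (f a) < n := by exact_mod_cast this
    omega

/-- A packing 5-coloring of `theta0`. -/
def col5 (a : Fin 16) : ℕ := [1, 1, 2, 1, 5, 2, 2, 5, 2, 3, 1, 2, 4, 3, 4, 3].getD a.val 0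

theorem col5_range : ∀ a, 1 ≤ col5 a ∧ col5 a ≤ 5 := by decide +kernel

theorem col5_far : ∀ a b, a ≠ b → col5 a = col5 b →
    reachB (col5 a) a b = false ∧ reachB (col5 a) b a = false := by
  decide +kernel

theorem col5_ok : IsDirPackingColoring theta0 5 col5 := by
  refine ⟨col5_range, fun x y hxy hc => ?_⟩
  obtain ⟨h1, h2⟩ := col5_far x y hxy hc
  have h3 : ((col5 x + 1 : ℕ) : ℕ∞) ≤ weakEDist theta0 x y := by
    refine le_sInf ?_
    rintro _ ⟨m, hm, rfl⟩
    by_contra hlt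
    have hlt : m ≤ col5 x := by
      have : m < col5 x + 1 := by exact_mod_cast not_le.1 hlt
      omega
    rcases hm with hm | hm
    · rw [(reachB_iff _ _ _).2 ⟨m, hlt, hm⟩] at h1
      cases h1
    · rw [(reachB_iff _ _ _).2 ⟨m, hlt, hm⟩] at h2
      cases h2
  refine lt_of_lt_of_le ?_ h3
  exact_mod_cast Nat.lt_succ_self _

theorem stmt15 :
    dirPackingChromaticNumber theta0 = 5 ∧
    ∀ (W : Type) (B : W → W → Prop), (∀ x y, B x y → ¬ B y x) →
      ∀ f : Fin 16 → W, Function.Injective f →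
        (∀ a b, theta0 a b → B (f a) (f b)) →
        ∀ (k : ℕ) (π : W → ℕ), IsDirPackingColoring B k π → 5 ≤ k := by
  refine ⟨le_antisymm (Nat.sInf_le ⟨col5, col5_ok⟩) ?_, ?_⟩
  · refine le_csInf ⟨5, col5, col5_ok⟩ ?_
    rintro k ⟨π, h⟩
    exact lower_bound theta0 id Function.injective_id (fun _ _ h => h) k π h
  · intro W B _ f hf hB k π h
    exact lower_bound B f hf hB k π h
end

section
/- For every orientation →Θ of a generalized theta graph Θ_{ℓ1,…,ℓp} with p ≥ 2 in which every path has length at least 5 (i.e., ℓ_i ≥ 5 for all i, equivalently n_1 = n_2 = n_3 = n_4 = 0), one has χρ(→Θ) ≤ 4. -/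
/-- Color of the vertex at position `j` (with `0 < j < L`) on a path of length `L`. -/
def thetaPosColor (L j : ℕ) : ℕ :=
  if L % 2 = 0 then (if j % 2 = 1 then 1 else if j % 4 = 2 then 2 else 3)
  else if j = 1 then 1 else if j = 2 then 2
  else if j % 2 = 0 then 1 else if j % 4 = 3 then 3 else 2

def thetaColor (p : ℕ) (ℓ : Fin p → ℕ) : ThetaVert p ℓ → ℕ
  | Sum.inl _ => 4
  | Sum.inr ⟨i, j⟩ => thetaPosColor (ℓ i) ((j : ℕ) + 1)

/-- Distance from the internal vertex at position `a` of path `i`, truncated at `4`. -/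
def thetaPot (p : ℕ) (ℓ : Fin p → ℕ) (i : Fin p) (a : ℕ) : ThetaVert p ℓ → ℕ
  | Sum.inl false => min a 4
  | Sum.inl true => min (ℓ i - a) 4
  | Sum.inr ⟨k, j⟩ =>
      if i = k then min ((a - ((j : ℕ) + 1)) + (((j : ℕ) + 1) - a)) 4
      else min (min (a + ((j : ℕ) + 1)) ((ℓ i - a) + (ℓ k - ((j : ℕ) + 1)))) 4

/-- Distance from `u`, truncated at `5`. -/
def thetaPotU (p : ℕ) (ℓ : Fin p → ℕ) : ThetaVert p ℓ → ℕ
  | Sum.inl false => 0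
  | Sum.inl true => 5
  | Sum.inr ⟨_, j⟩ => min ((j : ℕ) + 1) 5

def OneLip {V : Type*} (A : V → V → Prop) (f : V → ℕ) : Prop :=
  ∀ x y, A x y → f y ≤ f x + 1 ∧ f x ≤ f y + 1

theorem OneLip.dirPath {V : Type*} {A : V → V → Prop} {f : V → ℕ} (hf : OneLip A f) :
    ∀ (m : ℕ) (x y : V), DirPath A m x y → f y ≤ f x + m ∧ f x ≤ f y + m := by
  intro m
  induction m with
  | zero => intro x y h; obtain rfl : x = y := h; simp
  | succ m ih =>
    rintro x y ⟨z, hz, h⟩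
    have h1 := hf x z hz
    have h2 := ih z y h
    omega

theorem OneLip.lt_weakEDist {V : Type*} {A : V → V → Prop} {f : V → ℕ} (hf : OneLip A f)
    {x y : V} {c : ℕ} (h : f x + c < f y ∨ f y + c < f x) : (c : ℕ∞) < weakEDist A x y := by
  have h1 : ((c + 1 : ℕ) : ℕ∞) ≤ weakEDist A x y := by
    apply le_sInf
    rintro n ⟨m, hm, rfl⟩
    have : c + 1 ≤ m := by
      rcases hm with hm | hm
      · have := hf.dirPath m _ _ hm; omega
      · have := hf.dirPath m _ _ hm; omega
    exact_mod_cast this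
  refine lt_of_lt_of_le ?_ h1
  exact_mod_cast Nat.lt_succ_self c

theorem oneLip_of_rel {p : ℕ} {ℓ : Fin p → ℕ} {A : ThetaVert p ℓ → ThetaVert p ℓ → Prop}
    (hA : IsOrientation (thetaGraph p ℓ) A) {f : ThetaVert p ℓ → ℕ}
    (h : OneLip (thetaRel p ℓ) f) : OneLip A f := by
  intro x y hxy
  have h1 : (thetaGraph p ℓ).Adj x y := (hA.1 x y).2 (Or.inl hxy)
  have h2 := (SimpleGraph.fromRel_adj _ _ _).1 h1
  rcases h2.2 with h3 | h3
  · exact h x y h3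
  · exact (h y x h3).symm

theorem oneLip_potU {p : ℕ} {ℓ : Fin p → ℕ} (h5 : ∀ i, 5 ≤ ℓ i) :
    OneLip (thetaRel p ℓ) (thetaPotU p ℓ) := by
  rintro (a | ⟨i, j⟩) (b | ⟨k, l⟩) h
  · obtain ⟨_, _, i, hi⟩ := h
    have := h5 i; omega
  · have := h5 k
    rcases h with ⟨rfl, h⟩ | ⟨rfl, h⟩ <;> simp only [thetaPotU] <;> omega
  · exact h.elim
  · obtain ⟨_, h⟩ := h
    simp only [thetaPotU]; omega

theorem oneLip_pot {p : ℕ} {ℓ : Fin p → ℕ} (h5 : ∀ i, 5 ≤ ℓ i) (i : Fin p) (a : ℕ)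
    (ha : a < ℓ i) : OneLip (thetaRel p ℓ) (thetaPot p ℓ i a) := by
  have hi5 := h5 i
  rintro (b | ⟨k, j⟩) (b' | ⟨k', l⟩) h
  · obtain ⟨_, _, i, hi⟩ := h
    have := h5 i; omega
  · have := h5 k'
    have := l.2
    by_cases hk : i = k'
    · subst hk
      rcases h with ⟨rfl, h⟩ | ⟨rfl, h⟩ <;> simp only [thetaPot, if_true] <;> omega
    · rcases h with ⟨rfl, h⟩ | ⟨rfl, h⟩ <;> simp only [thetaPot, if_neg hk] <;> omega
  · exact h.elim
  · obtain ⟨h0, h⟩ := h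
    obtain rfl : k = k' := Fin.ext h0
    have := l.2
    by_cases hk : i = k
    · subst hk
      simp only [thetaPot, if_true]; omega
    · simp only [thetaPot, if_neg hk]; omega

theorem thetaPosColor_range (L j : ℕ) : 1 ≤ thetaPosColor L j ∧ thetaPosColor L j ≤ 3 := by
  unfold thetaPosColor; split_ifs <;> omega

theorem thetaPosColor_same (L a b : ℕ) (ha : 1 ≤ a) (hb : 1 ≤ b) (hab : a ≠ b)
    (h : thetaPosColor L a = thetaPosColor L b) :
    thetaPosColor L a < (a - b) + (b - a) := by
  unfold thetaPosColor at *; split_ifs at * <;> omega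

theorem thetaPosColor_end (L a : ℕ) (ha : 1 ≤ a) (haL : a < L) (h5 : 5 ≤ L) :
    thetaPosColor L a = 1 ∨ (2 ≤ a ∧ a + 2 ≤ L) := by
  unfold thetaPosColor; split_ifs <;> omega

theorem theta_coloring {p : ℕ} {ℓ : Fin p → ℕ} (h5 : ∀ i, 5 ≤ ℓ i)
    {A : ThetaVert p ℓ → ThetaVert p ℓ → Prop}
    (hA : IsOrientation (thetaGraph p ℓ) A) :
    IsDirPackingColoring A 4 (thetaColor p ℓ) := by
  constructor
  · rintro (a | ⟨i, j⟩)
    · simp [thetaColor]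
    · have := thetaPosColor_range (ℓ i) ((j : ℕ) + 1)
      simp only [thetaColor]; omega
  · rintro (a | ⟨i, j⟩) (b | ⟨k, l⟩) hne hc
    · apply (oneLip_of_rel hA (oneLip_potU h5)).lt_weakEDist
      cases a <;> cases b <;> first
        | exact absurd rfl hne
        | simp [thetaPotU, thetaColor]
    · have := thetaPosColor_range (ℓ k) ((l : ℕ) + 1)
      simp only [thetaColor] at hc; omega
    · have := thetaPosColor_range (ℓ i) ((j : ℕ) + 1)
      simp only [thetaColor] at hc; omega
    · have hj := j.2
      have hl := l.2
      apply (oneLip_of_rel hA (oneLip_pot h5 i ((j : ℕ) + 1) (by omega))).lt_weakEDist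
      left
      have r1 := thetaPosColor_range (ℓ i) ((j : ℕ) + 1)
      have hi5 := h5 i
      have hk5 := h5 k
      by_cases hk : i = k
      · subst hk
        have hjl : (j : ℕ) ≠ l := by
          intro h
          exact hne (by rw [Fin.ext h])
        simp only [thetaColor] at hc
        have := thetaPosColor_same (ℓ i) _ _ (by omega) (by omega) (by omega) hc
        simp only [thetaPot, if_true, thetaColor]; omega
      · simp only [thetaColor] at hc
        have e1 := thetaPosColor_end (ℓ i) ((j : ℕ) + 1) (by omega) (by omega) hi5
        have e2 := thetaPosColor_end (ℓ k) ((l : ℕ) + 1) (by omega) (by omega) hk5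
        simp only [thetaPot, if_neg hk, if_true, thetaColor]; omega

theorem stmt16 (p : ℕ) (ℓ : Fin p → ℕ) (hp : 2 ≤ p)
    (hmono : Monotone ℓ) (h5 : ∀ i, 5 ≤ ℓ i)
    (A : ThetaVert p ℓ → ThetaVert p ℓ → Prop)
    (hA : IsOrientation (thetaGraph p ℓ) A) :
    dirPackingChromaticNumber A ≤ 4 := by
  exact Nat.sInf_le ⟨_, theta_coloring h5 hA⟩
end
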